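/- Fix θ > 0, an integer N ≥ 1, a = (a_1 > ⋯ > a_N) ∈ 𝒫_N, and y ∈ ℂ with Re y > 0. Fix any M < a_N and r > 0 and let C be the counter-clockwise oriented contour consisting of the vertical segment from M + ri to M − ri together with the two horizontal rays from +∞ + ri to M + ri and from M − ri to +∞ − ri. Then the contour integral below converges absolutely and 𝓑_a(−y, 0^{N−1}; θ) = −( Γ(θN) / y^{θN−1} ) · (1/(2πi)) ∫_C exp(−yz) ∏_{i=1}^N (a_i − z)^{−θ} dz, where (a_i − z)^{−θ} := exp(−θ Log(a_i − z)) with Log the principal branch of the logarithm on ℂ ∖ (−∞, 0]. -/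

import Mathlib

open MeasureTheory Filter Topology
open scoped ENNReal

noncomputable section

/-- A triangular array with `M` levels: for `k : Fin M`, level `k+1` has `k+1` real entries. -/
abbrev Tri (M : ℕ) := ∀ k : Fin M, Fin (k.1 + 1) → ℝ

/-- `Interlaces u v` means `u ≺ v`, i.e. `v 1 > u 1 > v 2 > u 2 > ⋯ > v n > u n > v (n+1)`. -/
def Interlaces {n : ℕ} (u : Fin n → ℝ) (v : Fin (n + 1) → ℝ) : Prop :=
  ∀ i : Fin n, u i < v i.castSucc ∧ v i.succ < u i

/-- Level `k+1` (for `k < N`) of the configuration consisting of the triangular array `x`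
(levels `1, …, N-1`) together with the top level `a` (level `N`). -/
def lvl {N : ℕ} (a : Fin N → ℝ) (x : Tri (N - 1)) (k : ℕ) (hk : k < N) :
    Fin (k + 1) → ℝ :=
  if h : k < N - 1 then fun i => x ⟨k, h⟩ i
  else fun i => a ⟨i.1, by have := i.isLt; omega⟩

/-- The (unnormalized) density of the orbital beta process with top level `a`. -/
def obpWt (θ : ℝ) {N : ℕ} (a : Fin N → ℝ) (x : Tri (N - 1)) : ℝ :=
  ∏ k : Fin (N - 1),
    ((∏ i : Fin (k.1 + 1), ∏ j : Fin (k.1 + 1),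
        if i < j then |x k i - x k j| ^ (2 - 2 * θ) else 1) *
      ∏ s : Fin (k.1 + 2), ∏ r : Fin (k.1 + 1),
        |lvl a x (k.1 + 1) (by have := k.isLt; omega) s - x k r| ^ (θ - 1))

/-- The interlacing scheme `𝒫(a)`: arrays `(a⁽¹⁾ ≺ a⁽²⁾ ≺ ⋯ ≺ a⁽ᴺ⁻¹⁾ ≺ a)`. -/
def obpDomain {N : ℕ} (a : Fin N → ℝ) : Set (Tri (N - 1)) :=
  {x | ∀ k : Fin (N - 1),
      Interlaces (x k) (lvl a x (k.1 + 1) (by have := k.isLt; omega))}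

/-- The orbital beta process `𝕄^{a,θ}` with top level `a`. -/
def obp (θ : ℝ) {N : ℕ} (a : Fin N → ℝ) : Measure (Tri (N - 1)) :=
  (ENNReal.ofReal (∫ x in obpDomain a, obpWt θ a x))⁻¹ •
    volume.withDensity fun x =>
      ENNReal.ofReal ((obpDomain a).indicator (obpWt θ a) x)

/-- The Weyl chamber `𝒲_m = {x : x 0 ≥ x 1 ≥ ⋯}`. -/
def weylChamber (m : ℕ) : Set (Fin m → ℝ) :=
  {x | ∀ i j : Fin m, i ≤ j → x j ≤ x i}

/-- The (unnormalized) density of the Gaussian beta ensemble. -/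
def gbeWt (θ : ℝ) (m : ℕ) (x : Fin m → ℝ) : ℝ :=
  (∏ i : Fin m, ∏ j : Fin m, if i < j then |x i - x j| ^ (2 * θ) else 1) *
    Real.exp (-(θ / 2) * ∑ i, x i ^ 2)

/-- The Gaussian beta ensemble `𝕄^{(θ)}_m` of rank `m`. -/
def gbe (θ : ℝ) (m : ℕ) : Measure (Fin m → ℝ) :=
  (ENNReal.ofReal (∫ x in weylChamber m, gbeWt θ m x))⁻¹ •
    volume.withDensity fun x =>
      ENNReal.ofReal ((weylChamber m).indicator (gbeWt θ m) x)

/-- The empirical measure `μ_N = (1/N) ∑ δ_{a_i/N}`. -/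
def empMeasure {N : ℕ} (a : Fin N → ℝ) : Measure ℝ :=
  ((N : ℝ≥0∞))⁻¹ • ∑ i : Fin N, Measure.dirac (a i / N)

/-- The mean `𝔼[ν]` of a measure on `ℝ`. -/
def meanM (ν : Measure ℝ) : ℝ := ∫ t, t ∂ν

/-- The variance `Var[ν]` of a measure on `ℝ`. -/
def varM (ν : Measure ℝ) : ℝ := (∫ t, t ^ 2 ∂ν) - meanM ν ^ 2

/-- A regular sequence of ordered tuples with limiting measure `μ`. -/
def RegularSeq (a : (N : ℕ) → Fin N → ℝ) (μ : Measure ℝ) : Prop :=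
  (∀ N : ℕ, 1 ≤ N → StrictAnti (a N)) ∧
  (∃ C : ℝ, ∀ N : ℕ, ∀ hN : 1 ≤ N,
      |a N ⟨0, by omega⟩| ≤ C * N ∧ |a N ⟨N - 1, by omega⟩| ≤ C * N) ∧
  IsProbabilityMeasure μ ∧
  (∃ R : ℝ, μ {t : ℝ | |t| ≤ R}ᶜ = 0) ∧
  ∀ f : BoundedContinuousFunction ℝ ℝ,
    Tendsto (fun N : ℕ => ∫ t, f t ∂empMeasure (a N)) atTop (𝓝 (∫ t, f t ∂μ))

/-- Projection of a triangular array (with top level of size `N`) to its `m`-th level. -/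
def levelProj {N : ℕ} (m : ℕ) (h1 : 1 ≤ m) (h2 : m < N) (x : Tri (N - 1)) :
    Fin m → ℝ :=
  fun i => x ⟨m - 1, by omega⟩ ⟨i.1, (by have := i.isLt; omega : i.1 < m - 1 + 1)⟩

/-- Projection of a triangular array to its bottom `m` levels. -/
def triProj {N : ℕ} (m : ℕ) (h : m < N) (x : Tri (N - 1)) : Tri m :=
  fun k i => x ⟨k.1, by have := k.isLt; omega⟩ ⟨i.1, i.isLt⟩

/-- The top level of a triangular array with `m` levels. -/
def topLvl {m : ℕ} (hm : 1 ≤ m) (x : Tri m) : Fin m → ℝ :=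
  fun i => x ⟨m - 1, by omega⟩ ⟨i.1, (by have := i.isLt; omega : i.1 < m - 1 + 1)⟩

/-- The Gelfand–Tsetlin polytope `𝒲_{m,corners}` (weak interlacing). -/
def gtPoly (m : ℕ) : Set (Tri m) :=
  {x | ∀ k : Fin m, ∀ hk : k.1 + 1 < m, ∀ i : Fin (k.1 + 1),
      x k i ≤ x ⟨k.1 + 1, hk⟩ i.castSucc ∧ x ⟨k.1 + 1, hk⟩ i.succ ≤ x k i}

/-- Unnormalized density of the Gaussian beta corners process with `m` levels. -/
def gbcWt (θ : ℝ) {m : ℕ} (hm : 1 ≤ m) (x : Tri m) : ℝ :=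
  (∏ i : Fin m, ∏ j : Fin m,
      if i < j then topLvl hm x i - topLvl hm x j else 1) *
    Real.exp (-(θ / 2) * ∑ i, topLvl hm x i ^ 2) *
    ∏ k : Fin (m - 1),
      ((∏ i : Fin (k.1 + 1), ∏ j : Fin (k.1 + 1),
          if i < j then
            |x ⟨k.1, by have := k.isLt; omega⟩ i -
              x ⟨k.1, by have := k.isLt; omega⟩ j| ^ (2 - 2 * θ)
          else 1) *
        ∏ i : Fin (k.1 + 1), ∏ j : Fin (k.1 + 2),
          |x ⟨k.1, by have := k.isLt; omega⟩ i -
            x ⟨k.1 + 1, by have := k.isLt; omega⟩ j| ^ (θ - 1))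

/-- The Gaussian beta corners process `𝕄^{(θ)}_{m,corners}`. -/
def gbc (θ : ℝ) {m : ℕ} (hm : 1 ≤ m) : Measure (Tri m) :=
  (ENNReal.ofReal (∫ x in gtPoly m, gbcWt θ hm x))⁻¹ •
    volume.withDensity fun x =>
      ENNReal.ofReal ((gtPoly m).indicator (gbcWt θ hm) x)

/-- Strict interlacing domain `x⁽¹⁾ ≺ x⁽²⁾ ≺ ⋯ ≺ x⁽ᵐ⁾` inside `Tri m`. -/
def triDomain (m : ℕ) : Set (Tri m) :=
  {x | ∀ k : Fin m, ∀ hk : k.1 + 1 < m, Interlaces (x k) (x ⟨k.1 + 1, hk⟩)}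

/-- The θ-Gibbs conditional density of the bottom `n` levels given level `n+1`. -/
def gibbsWt (θ : ℝ) (n : ℕ) (x : Tri (n + 1)) : ℝ :=
  ((∏ k : Fin (n + 1), Real.Gamma ((k.1 + 1) * θ)) /
      Real.Gamma θ ^ ((n + 1) * (n + 2) / 2)) *
    (∏ i : Fin (n + 1), ∏ j : Fin (n + 1),
      if i < j then
        (x ⟨n, Nat.lt_succ_self n⟩ i - x ⟨n, Nat.lt_succ_self n⟩ j) ^ (1 - 2 * θ)
      else 1) *
    ∏ k : Fin n,
      ((∏ i : Fin (k.1 + 1), ∏ j : Fin (k.1 + 1),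
          if i < j then
            (x ⟨k.1, by have := k.isLt; omega⟩ i -
              x ⟨k.1, by have := k.isLt; omega⟩ j) ^ (2 - 2 * θ)
          else 1) *
        ∏ i : Fin (k.1 + 1), ∏ j : Fin (k.1 + 2),
          |x ⟨k.1, by have := k.isLt; omega⟩ i -
            x ⟨k.1 + 1, by have := k.isLt; omega⟩ j| ^ (θ - 1))

/-- `|a⁽ᵏ⁾|`, the sum of the entries of level `k` (with `a⁽⁰⁾ := 0` and `a⁽ᴺ⁾ := a`). -/
def sumLvl {N : ℕ} (a : Fin N → ℝ) (x : Tri (N - 1)) (k : ℕ) : ℝ :=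
  if k = 0 then 0
  else if h : k - 1 < N - 1 then ∑ i, x ⟨k - 1, h⟩ i
  else ∑ i, a i

/-- The multivariate Bessel function `𝓑_a(y; θ)`, defined through its combinatorial
integral representation over the interlacing scheme with top level `a`. -/
def MBF (θ : ℝ) {N : ℕ} (a : Fin N → ℝ) (y : Fin N → ℂ) : ℂ :=
  ((((∏ k : Fin N, Real.Gamma ((k.1 + 1) * θ)) /
        Real.Gamma θ ^ (N * (N + 1) / 2)) : ℝ) : ℂ) *
    (((∏ i : Fin N, ∏ j : Fin N,
        if i < j then |a i - a j| ^ (1 - 2 * θ) else 1) : ℝ) : ℂ) *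
    ∫ x in obpDomain a,
      Complex.exp (∑ k : Fin N,
        y k * ((sumLvl a x (k.1 + 1) - sumLvl a x k.1 : ℝ) : ℂ)) *
      ((obpWt θ a x : ℝ) : ℂ)

/-- Padding of an `m`-tuple with `N - m` zeros: `(y_1, …, y_m, 0^{N-m})`. -/
def padC {m N : ℕ} (_h : m ≤ N) (y : Fin m → ℂ) : Fin N → ℂ :=
  fun k => if h' : k.1 < m then y ⟨k.1, h'⟩ else 0

/-- Integrand `exp(yz) ∏ (z - a_i)^{-θ}` of the left-directed contour integral,
with `w^{-θ} := exp(-θ Log w)` for the principal branch `Log`. -/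
def contourFnL (θ : ℝ) {N : ℕ} (a : Fin N → ℝ) (y z : ℂ) : ℂ :=
  Complex.exp (y * z) *
    ∏ i : Fin N, Complex.exp (-(θ : ℂ) * Complex.log (z - (a i : ℂ)))

/-- Integrand `exp(-yz) ∏ (a_i - z)^{-θ}` of the right-directed contour integral. -/
def contourFnR (θ : ℝ) {N : ℕ} (a : Fin N → ℝ) (y z : ℂ) : ℂ :=
  Complex.exp (-y * z) *
    ∏ i : Fin N, Complex.exp (-(θ : ℂ) * Complex.log ((a i : ℂ) - z))

/-- `(y_1, …, y_m, y_{m+1})` with `y_{m+1} := y - (z_1 + ⋯ + z_m)`. -/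
def Yext {m : ℕ} (ys : Fin m → ℝ) (y : ℝ) (z : Fin m → ℝ) : Fin (m + 1) → ℝ :=
  fun j => if h : j.1 < m then ys ⟨j.1, h⟩ else y - ∑ i, z i

/-- `(z_1, …, z_m, z_{m+1})` with `z_{m+1} := 0`. -/
def Zext {m : ℕ} (z : Fin m → ℝ) : Fin (m + 1) → ℝ :=
  fun j => if h : j.1 < m then z ⟨j.1, h⟩ else 0

/-- The function `G_{θ, y_1, …, y_m, y}(z_1, …, z_m)`. -/
def Gfn (θ : ℝ) {m : ℕ} (ys : Fin m → ℝ) (y : ℝ) (z : Fin m → ℝ) : ℝ :=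
  (∏ i : Fin m, ∏ j : Fin m,
      if i < j then (ys i - ys j + z i) ^ (θ - 1) else 1) *
    ∏ i : Fin (m + 1), ∏ j : Fin (m + 1),
      if i < j then
        (Yext ys y z i - Yext ys y z j + Zext z i - Zext z j) *
          (Yext ys y z i - Yext ys y z j - Zext z j) ^ (θ - 1)
      else 1

/-- The function `F_{y_1, …, y_m, y}(z_1, …, z_m)`. -/
def Ffn {m : ℕ} (ys : Fin m → ℝ) (y : ℝ) (z : Fin m → ℝ) : ℝ :=
  (1 - (∑ i, z i) / y) * ∏ i, (1 + z i / ys i)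

/-- An integral of holomorphic functions that are locally uniformly dominated by an integrable
function is holomorphic. -/
theorem differentiableOn_integral_of_locally_dominated {X : Type*} [MeasurableSpace X]
    {μ : Measure X} {F : ℂ → X → ℂ} {U : Set ℂ} (hU : IsOpen U)
    (hmeas : ∀ z ∈ U, AEStronglyMeasurable (F z) μ)
    (hdiff : ∀ᵐ x ∂μ, DifferentiableOn ℂ (fun z => F z x) U)
    (hb : ∀ z₀ ∈ U, ∃ ε > 0, ∃ B : X → ℝ, Integrable B μ ∧
      ∀ᵐ x ∂μ, ∀ z ∈ Metric.ball z₀ ε, ‖F z x‖ ≤ B x) :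
    DifferentiableOn ℂ (fun z => ∫ x, F z x ∂μ) U := by
  intro z₀ hz₀
  obtain ⟨ε₁, hε₁, B, hB, hFB⟩ := hb z₀ hz₀
  obtain ⟨ε₂, hε₂, hball⟩ := Metric.isOpen_iff.1 hU z₀ hz₀
  set ε := min ε₁ ε₂ with hε
  have hε0 : 0 < ε := lt_min hε₁ hε₂
  have hderiv : ∀ᵐ x ∂μ, ∀ z ∈ Metric.ball z₀ (ε / 2),
      HasDerivAt (fun z => F z x) (deriv (fun z => F z x) z) z := by
    filter_upwards [hdiff] with x hx z hz
    refine (hx.differentiableAt (hU.mem_nhds (hball ?_))).hasDerivAt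
    exact Metric.ball_subset_ball (by linarith [min_le_right ε₁ ε₂]) hz
  have hbd : ∀ᵐ x ∂μ, ∀ z ∈ Metric.ball z₀ (ε / 2),
      ‖deriv (fun z => F z x) z‖ ≤ B x / (ε / 4) := by
    filter_upwards [hdiff, hFB] with x hx hFx z hz
    have hsub : Metric.closedBall z (ε / 4) ⊆ Metric.ball z₀ ε := by
      intro w hw
      rw [Metric.mem_closedBall] at hw
      rw [Metric.mem_ball] at hz ⊢
      linarith [dist_triangle w z z₀]
    refine Complex.norm_deriv_le_of_forall_mem_sphere_norm_le (by linarith) ?_ ?_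
    · refine DifferentiableOn.diffContOnCl ?_
      refine hx.mono ?_
      rw [closure_ball _ (by linarith)]
      exact (hsub.trans (Metric.ball_subset_ball (min_le_right _ _))).trans hball
    · intro w hw
      exact hFx w (Metric.ball_subset_ball (min_le_left _ _)
        (hsub (Metric.sphere_subset_closedBall hw)))
  have hmem : Metric.ball z₀ (ε / 2) ∈ 𝓝 z₀ := Metric.ball_mem_nhds _ (by linarith)
  have hmeas' : AEStronglyMeasurable (fun x => deriv (fun z => F z x) z₀) μ := by
    set h : ℕ → ℂ := fun n => ((ε / 4 / (n + 1) : ℝ) : ℂ) with hh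
    have hh0 : Tendsto h atTop (𝓝[≠] 0) := by
      refine tendsto_nhdsWithin_iff.2 ⟨?_, Eventually.of_forall fun n => ?_⟩
      · have : Tendsto (fun n : ℕ => ε / 4 / ((n : ℝ) + 1)) atTop (𝓝 0) := by
          simpa [div_eq_mul_inv] using
            (tendsto_one_div_add_atTop_nhds_zero_nat (𝕜 := ℝ)).const_mul (ε / 4)
        exact (Complex.continuous_ofReal.tendsto' 0 0 Complex.ofReal_zero).comp this
      · have : ε / 4 / ((n : ℝ) + 1) ≠ 0 := by positivity
        exact Complex.ofReal_ne_zero.2 this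
    refine aestronglyMeasurable_of_tendsto_ae (u := atTop)
      (f := fun n x => (h n)⁻¹ • (F (z₀ + h n) x - F z₀ x)) (fun n => ?_) ?_
    · refine AEStronglyMeasurable.const_smul ((hmeas (z₀ + h n) (hball ?_)).sub (hmeas _ hz₀))
        (h n)⁻¹
      rw [Metric.mem_ball, dist_eq_norm, add_sub_cancel_left, Complex.norm_real, Real.norm_eq_abs,
        abs_of_pos (by positivity)]
      have : ε / 4 / ((n : ℝ) + 1) ≤ ε / 4 := div_le_self (by linarith) (by simp)
      linarith [min_le_right ε₁ ε₂]
    · filter_upwards [hderiv] with x hx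
      have := (hx z₀ (Metric.mem_ball_self (by linarith))).tendsto_slope_zero
      exact this.comp hh0
  refine (hasDerivAt_integral_of_dominated_loc_of_deriv_le hmem ?_ ?_ hmeas' hbd
    (hB.div_const _) hderiv).2.differentiableAt.differentiableWithinAt
  · filter_upwards [hU.mem_nhds hz₀] with z hz using hmeas z hz
  · refine hB.mono' (hmeas z₀ hz₀) ?_
    filter_upwards [hFB] with x hx using hx z₀ (Metric.mem_ball_self hε₁)

theorem frequently_nhdsNE_of_eventually_ofReal {p : ℂ → Prop} {x₀ : ℝ}
    (h : ∀ᶠ x : ℝ in 𝓝 x₀, p x) : ∃ᶠ z in 𝓝[≠] (x₀ : ℂ), p z := by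
  have ht : Tendsto (fun x : ℝ => (x : ℂ)) (𝓝[≠] x₀) (𝓝[≠] (x₀ : ℂ)) :=
    tendsto_nhdsWithin_of_tendsto_nhds_of_eventually_within _
      (Complex.continuous_ofReal.continuousAt.mono_left nhdsWithin_le_nhds)
      (eventually_nhdsWithin_of_forall fun x hx => by simpa using hx)
  exact ht.frequently (h.filter_mono nhdsWithin_le_nhds).frequently

theorem measurable_finSnoc {n : ℕ} {α : Fin (n + 1) → Type*} [∀ i, MeasurableSpace (α i)] :
    Measurable (fun p : (∀ i : Fin n, α i.castSucc) × α (Fin.last n) =>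
      (Fin.snoc p.1 p.2 : ∀ i, α i)) := by
  refine measurable_pi_lambda _ fun i => ?_
  refine Fin.lastCases ?_ (fun j => ?_) i
  · simpa using measurable_snd
  · simp only [Fin.snoc_castSucc]
    exact (measurable_pi_apply j).comp measurable_fst

/-- Appending a last coordinate is measure preserving. -/
theorem measurePreserving_finSnoc {n : ℕ} {α : Fin (n + 1) → Type*} [∀ i, MeasureSpace (α i)]
    [∀ i, SigmaFinite (volume : Measure (α i))] :
    MeasurePreserving (fun p : (∀ i : Fin n, α i.castSucc) × α (Fin.last n) =>
      (Fin.snoc p.1 p.2 : ∀ i, α i)) := by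
  refine ⟨measurable_finSnoc, ?_⟩
  symm
  refine Measure.pi_eq fun s hs => ?_
  rw [Measure.map_apply measurable_finSnoc (MeasurableSet.univ_pi hs)]
  have : (fun p : (∀ i : Fin n, α i.castSucc) × α (Fin.last n) =>
      (Fin.snoc p.1 p.2 : ∀ i, α i)) ⁻¹' Set.univ.pi s =
      (Set.univ.pi fun i : Fin n => s i.castSucc) ×ˢ s (Fin.last n) := by
    ext p
    simp only [Set.mem_preimage, Set.mem_pi, Set.mem_univ, true_imp_iff, Set.mem_prod]
    constructor
    · intro h
      exact ⟨fun i => by simpa using h i.castSucc, by simpa using h (Fin.last n)⟩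
    · rintro ⟨h1, h2⟩ i
      refine Fin.lastCases ?_ (fun j => ?_) i
      · simpa using h2
      · simpa using h1 j
  rw [this, Measure.volume_eq_prod, Measure.prod_prod, volume_pi_pi, Fin.prod_univ_castSucc]

/-- Appending a last coordinate is a measurable embedding. -/
theorem measurableEmbedding_finSnoc {n : ℕ} {α : Fin (n + 1) → Type*}
    [∀ i, MeasurableSpace (α i)] :
    MeasurableEmbedding (fun p : (∀ i : Fin n, α i.castSucc) × α (Fin.last n) =>
      (Fin.snoc p.1 p.2 : ∀ i, α i)) := by
  refine MeasurableEmbedding.of_measurable_inverse (g := fun v => (Fin.init v, v (Fin.last n)))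
    measurable_finSnoc ?_ ?_ ?_
  · convert MeasurableSet.univ
    refine Set.range_eq_univ.2 fun v => ⟨(Fin.init v, v (Fin.last n)), by simp⟩
  · exact (measurable_pi_lambda _ fun i => measurable_pi_apply i.castSucc).prodMk
      (measurable_pi_apply _)
  · rintro ⟨p, q⟩
    simp

/-- The Gamma integral with a complex rate of positive real part. -/
theorem integral_rpow_mul_cexp_neg_mul_Ioi {s : ℝ} (hs : 0 < s) {y : ℂ} (hy : 0 < y.re) :
    ∫ t in Set.Ioi (0 : ℝ), ((t ^ (s - 1) : ℝ) : ℂ) * Complex.exp (-y * t) =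
      Real.Gamma s * Complex.exp (-(s : ℂ) * Complex.log y) := by
  set U : Set ℂ := {z | 0 < z.re} with hUdef
  have hU : IsOpen U := isOpen_lt continuous_const Complex.continuous_re
  have hconv : Convex ℝ U := convex_halfSpace_re_gt 0
  have hslit : ∀ z ∈ U, z ∈ Complex.slitPlane := fun z hz => Or.inl hz
  have hmeas : ∀ z : ℂ, Measurable fun t : ℝ => ((t ^ (s - 1) : ℝ) : ℂ) * Complex.exp (-z * t) :=
    fun z => by fun_prop
  have h1 : DifferentiableOn ℂ (fun z : ℂ => ∫ t in Set.Ioi (0 : ℝ),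
      ((t ^ (s - 1) : ℝ) : ℂ) * Complex.exp (-z * t)) U := by
    refine differentiableOn_integral_of_locally_dominated hU
      (fun z _ => (hmeas z).aestronglyMeasurable) ?_ ?_
    · refine Eventually.of_forall fun t => ?_
      fun_prop
    · intro z₀ hz₀
      have hz₀' : 0 < z₀.re := hz₀
      refine ⟨z₀.re / 2, by linarith, fun t => t ^ (s - 1) * Real.exp (-(z₀.re / 2) * t), ?_, ?_⟩
      · have := integrableOn_rpow_mul_exp_neg_mul_rpow (p := 1) (s := s - 1) (b := z₀.re / 2)
          (by linarith) one_pos (by linarith)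
        simpa [IntegrableOn] using this
      · rw [ae_restrict_iff' measurableSet_Ioi]
        refine Eventually.of_forall fun t ht z hz => ?_
        have ht' : (0 : ℝ) < t := ht
        rw [norm_mul, Complex.norm_real, Complex.norm_exp, Real.norm_eq_abs,
          abs_of_pos (Real.rpow_pos_of_pos ht' _)]
        have hre : z₀.re / 2 ≤ z.re := by
          have h2 := Complex.abs_re_le_norm (z - z₀)
          rw [Metric.mem_ball, dist_eq_norm] at hz
          rw [Complex.sub_re] at h2
          linarith [(abs_le.1 h2).1]
        have : (-z * (t : ℂ)).re = -(z.re * t) := by simp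
        rw [this]
        refine mul_le_mul_of_nonneg_left (Real.exp_le_exp.2 ?_) (Real.rpow_nonneg ht'.le _)
        nlinarith
  have h2 : DifferentiableOn ℂ
      (fun z : ℂ => (Real.Gamma s : ℂ) * Complex.exp (-(s : ℂ) * Complex.log z)) U := by
    intro z hz
    exact (((Complex.differentiableAt_log (hslit z hz)).const_mul _).cexp.const_mul
      _).differentiableWithinAt
  refine (h1.analyticOnNhd hU).eqOn_of_preconnected_of_frequently_eq (h2.analyticOnNhd hU)
    hconv.isPreconnected (z₀ := ((1 : ℝ) : ℂ)) (by simp [hUdef]) ?_ hy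
  have hev : ∀ x : ℝ, 0 < x → (∫ t in Set.Ioi (0 : ℝ),
      ((t ^ (s - 1) : ℝ) : ℂ) * Complex.exp (-(x : ℂ) * t)) =
      (Real.Gamma s : ℂ) * Complex.exp (-(s : ℂ) * Complex.log x) := by
    intro x hx
    have h3 := Real.integral_rpow_mul_exp_neg_mul_Ioi hs hx
    have h4 : ∫ t in Set.Ioi (0 : ℝ), ((t ^ (s - 1) : ℝ) : ℂ) * Complex.exp (-(x : ℂ) * t) =
        ((∫ t in Set.Ioi (0 : ℝ), t ^ (s - 1) * Real.exp (-(x * t)) : ℝ) : ℂ) := by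
      rw [← integral_complex_ofReal]
      simp
    rw [h4, h3, ← Complex.ofReal_log hx.le, one_div, Real.inv_rpow hx.le, ← Real.rpow_neg hx.le,
      Real.rpow_def_of_pos hx]
    push_cast
    ring_nf
  exact frequently_nhdsNE_of_eventually_ofReal
    ((eventually_gt_nhds one_pos).mono hev)

/-- The absolute value of the Vandermonde product. -/
def absVdm {n : ℕ} (u : Fin n → ℝ) : ℝ :=
  ∏ i : Fin n, ∏ j : Fin n, if i < j then |u i - u j| else 1

theorem absVdm_pos {n : ℕ} {u : Fin n → ℝ} (hu : Function.Injective u) : 0 < absVdm u := by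
  refine Finset.prod_pos fun i _ => Finset.prod_pos fun j _ => ?_
  split_ifs with h
  · exact abs_pos.2 (sub_ne_zero.2 fun e => h.ne (hu e))
  · exact one_pos

theorem absVdm_nonneg {n : ℕ} (u : Fin n → ℝ) : 0 ≤ absVdm u := by
  refine Finset.prod_nonneg fun i _ => Finset.prod_nonneg fun j _ => ?_
  split_ifs <;> positivity

theorem prod_abs_sub_rpow {n : ℕ} (u : Fin n → ℝ) (p : ℝ) :
    (∏ i : Fin n, ∏ j : Fin n, if i < j then |u i - u j| ^ p else 1) = absVdm u ^ p := by
  rw [absVdm, ← Real.finsetProd_rpow]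
  · refine Finset.prod_congr rfl fun i _ => ?_
    rw [← Real.finsetProd_rpow]
    · refine Finset.prod_congr rfl fun j _ => ?_
      split_ifs <;> simp
    · intro j _
      split_ifs <;> positivity
  · intro i _
    refine Finset.prod_nonneg fun j _ => ?_
    split_ifs <;> positivity

theorem abs_det_vandermonde {n : ℕ} (u : Fin n → ℝ) :
    |(Matrix.vandermonde u).det| = absVdm u := by
  rw [Matrix.det_vandermonde, Finset.abs_prod, absVdm]
  refine Finset.prod_congr rfl fun i _ => ?_
  rw [Finset.abs_prod, ← Finset.prod_filter]
  refine Finset.prod_congr (by ext; simp) fun j _ => abs_sub_comm _ _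

theorem prod_abs_sub_eq_absVdm_sq {n : ℕ} (u : Fin n → ℝ) :
    (∏ i : Fin n, ∏ j : Fin n, if i = j then 1 else |u i - u j|) = absVdm u ^ 2 := by
  have h1 : ∀ i j : Fin n, (if i = j then 1 else |u i - u j|) =
      (if i < j then |u i - u j| else 1) * (if j < i then |u j - u i| else 1) := by
    intro i j
    rcases lt_trichotomy i j with h | h | h
    · simp [h, h.ne, h.not_gt]
    · simp [h]
    · simp [h, h.ne', h.not_gt, abs_sub_comm]
  simp_rw [h1, Finset.prod_mul_distrib]
  rw [sq, absVdm]
  congr 1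
  exact Finset.prod_comm

theorem prod_abs_sub_succAbove {m : ℕ} (b : Fin (m + 1) → ℝ) :
    (∏ i : Fin (m + 1), ∏ r : Fin m, |b i - b (i.succAbove r)|) = absVdm b ^ 2 := by
  rw [← prod_abs_sub_eq_absVdm_sq]
  refine Finset.prod_congr rfl fun i _ => ?_
  rw [Fin.prod_univ_succAbove _ i]
  simp [(Fin.succAbove_ne i _).symm]

theorem prod_abs_sub_erase {n : ℕ} (u : Fin n → ℝ) :
    (∏ i : Fin n, ∏ j ∈ Finset.univ.erase i, |u i - u j|) = absVdm u ^ 2 := by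
  rw [← prod_abs_sub_eq_absVdm_sq]
  refine Finset.prod_congr rfl fun i _ => ?_
  rw [← Finset.mul_prod_erase Finset.univ _ (Finset.mem_univ i), if_pos rfl, one_mul]
  refine Finset.prod_congr rfl fun j hj => ?_
  rw [if_neg (Finset.ne_of_mem_erase hj).symm]

theorem absVdm_snoc {m : ℕ} (u : Fin m → ℝ) (c : ℝ) :
    absVdm (Fin.snoc u c : Fin (m + 1) → ℝ) = absVdm u * ∏ r, |u r - c| := by
  rw [absVdm, Fin.prod_univ_castSucc]
  simp only [Fin.prod_univ_castSucc, Fin.snoc_castSucc, Fin.snoc_last, Fin.castSucc_lt_castSucc_iff,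
    Fin.castSucc_lt_last, if_true, lt_irrefl, if_false, Finset.prod_mul_distrib, absVdm]
  simp [not_lt.2 (Fin.le_last _)]

open Polynomial in
theorem det_eval_mul_det_vandermonde {m : ℕ} (p : Fin (m + 1) → ℝ[X])
    (hp : ∀ j, (p j).natDegree ≤ m) (x c : Fin (m + 1) → ℝ) :
    (Matrix.of fun i j => (p j).eval (x i)).det * (Matrix.vandermonde c).det =
      (Matrix.of fun i j => (p j).eval (c i)).det * (Matrix.vandermonde x).det := by
  have key : ∀ w : Fin (m + 1) → ℝ, (Matrix.of fun i j => (p j).eval (w i)) =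
      Matrix.vandermonde w * Matrix.of fun (i j : Fin (m + 1)) => (p j).coeff i := by
    intro w
    ext i j
    rw [Matrix.mul_apply, Matrix.of_apply,
      eval_eq_sum_range' (Nat.lt_succ_of_le (hp j)), ← Fin.sum_univ_eq_sum_range
        (fun k => (p j).coeff k * w i ^ k)]
    simp [Matrix.vandermonde, mul_comm]
  rw [key x, key c, Matrix.det_mul, Matrix.det_mul]
  ring

open Polynomial in
/-- The determinant of the matrix whose columns are the values at `b` of the products
`∏_{s ≠ r} (X - u s)` and `∏ s, (X - u s)`. -/
theorem abs_det_prod_sub {m : ℕ} {b : Fin (m + 1) → ℝ} {u : Fin m → ℝ}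
    (hu : Function.Injective u) (hub : ∀ r, u r ≠ b 0) :
    |(Matrix.of fun i j : Fin (m + 1) => (Fin.snoc
        (fun r => ∏ s ∈ Finset.univ.erase r, (b i - u s)) (∏ s, (b i - u s)) :
          Fin (m + 1) → ℝ) j).det| = absVdm u * absVdm b := by
  set p : Fin (m + 1) → ℝ[X] := Fin.snoc
    (fun r => ∏ s ∈ Finset.univ.erase r, (X - C (u s))) (∏ s, (X - C (u s))) with hp
  have hdeg : ∀ j, (p j).natDegree ≤ m := by
    intro j
    refine Fin.lastCases ?_ (fun r => ?_) j
    · simp only [hp, Fin.snoc_last]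
      rw [natDegree_prod_of_monic _ _ fun s _ => monic_X_sub_C _]
      simp
    · simp only [hp, Fin.snoc_castSucc]
      rw [natDegree_prod_of_monic _ _ fun s _ => monic_X_sub_C _]
      simp
  have heval : ∀ w : ℝ, ∀ j, (p j).eval w = (Fin.snoc
        (fun r => ∏ s ∈ Finset.univ.erase r, (w - u s)) (∏ s, (w - u s)) :
          Fin (m + 1) → ℝ) j := by
    intro w j
    refine Fin.lastCases ?_ (fun r => ?_) j
    · simp [hp, eval_prod]
    · simp [hp, eval_prod]
  have h := det_eval_mul_det_vandermonde p hdeg b (Fin.snoc u (b 0))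
  have htri : (Matrix.of fun i j => (p j).eval ((Fin.snoc u (b 0) : Fin (m + 1) → ℝ) i)).det =
      (∏ r, ∏ s ∈ Finset.univ.erase r, (u r - u s)) * ∏ s, (b 0 - u s) := by
    rw [Matrix.det_of_isLowerTriangular, Fin.prod_univ_castSucc]
    · simp [heval]
    · intro i j hij
      have hij' : i < j := by simpa using hij
      rw [Matrix.of_apply, heval]
      induction i using Fin.lastCases with
      | last => exact absurd hij' (not_lt.2 (Fin.le_last _))
      | cast i =>
        rw [Fin.snoc_castSucc]
        induction j using Fin.lastCases with
        | last =>
          rw [Fin.snoc_last]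
          exact Finset.prod_eq_zero (Finset.mem_univ i) (sub_self _)
        | cast j =>
          rw [Fin.snoc_castSucc]
          refine Finset.prod_eq_zero (Finset.mem_erase.2 ⟨?_, Finset.mem_univ i⟩) (sub_self _)
          exact (Fin.castSucc_lt_castSucc_iff.1 hij').ne
  rw [htri] at h
  simp_rw [heval] at h
  apply_fun abs at h
  rw [abs_mul, abs_mul, abs_det_vandermonde, abs_det_vandermonde, abs_mul, absVdm_snoc,
    Finset.abs_prod, Finset.abs_prod] at h
  simp_rw [Finset.abs_prod] at h
  rw [prod_abs_sub_erase] at h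
  have h1 : 0 < absVdm u := absVdm_pos hu
  have h2 : 0 < ∏ r, |u r - b 0| :=
    Finset.prod_pos fun r _ => abs_pos.2 (sub_ne_zero.2 (hub r))
  have h3 : ∏ r, |b 0 - u r| = ∏ r, |u r - b 0| :=
    Finset.prod_congr rfl fun r _ => abs_sub_comm _ _
  rw [h3] at h
  have h4 : absVdm u * ∏ r, |u r - b 0| ≠ 0 := (mul_pos h1 h2).ne'
  refine mul_right_cancel₀ h4 (h.trans ?_)
  ring

theorem Interlaces.lt_of_le {m : ℕ} {u : Fin m → ℝ} {b : Fin (m + 1) → ℝ} (hb : StrictAnti b)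
    (h : Interlaces u b) {r : Fin m} {i : Fin (m + 1)} (hi : i ≤ r.castSucc) : u r < b i :=
  (h r).1.trans_le (hb.antitone hi)

theorem Interlaces.lt_of_lt {m : ℕ} {u : Fin m → ℝ} {b : Fin (m + 1) → ℝ} (hb : StrictAnti b)
    (h : Interlaces u b) {r : Fin m} {i : Fin (m + 1)} (hi : r.castSucc < i) : b i < u r :=
  (hb.antitone (Fin.castSucc_lt_iff_succ_le.1 hi)).trans_lt (h r).2

theorem Interlaces.strictAnti {m : ℕ} {u : Fin m → ℝ} {b : Fin (m + 1) → ℝ} (hb : StrictAnti b)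
    (h : Interlaces u b) : StrictAnti u := fun r s hrs =>
  (h.lt_of_le hb (r := s) (i := r.succ) (Fin.succ_le_castSucc_iff.2 hrs)).trans (h r).2

theorem Interlaces.sub_ne_zero {m : ℕ} {u : Fin m → ℝ} {b : Fin (m + 1) → ℝ} (hb : StrictAnti b)
    (h : Interlaces u b) (i : Fin (m + 1)) (r : Fin m) : b i - u r ≠ 0 := by
  rcases le_or_gt i r.castSucc with hi | hi
  · exact (sub_pos.2 (h.lt_of_le hb hi)).ne'
  · exact (sub_neg.2 (h.lt_of_lt hb hi)).ne

theorem sub_succAbove_ne_zero {m : ℕ} {b : Fin (m + 1) → ℝ} (hb : StrictAnti b) (i : Fin (m + 1))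
    (r : Fin m) : b i - b (i.succAbove r) ≠ 0 :=
  sub_ne_zero.2 fun e => Fin.succAbove_ne i r (hb.injective e).symm

theorem prod_sub_succAbove_ne_zero {m : ℕ} {b : Fin (m + 1) → ℝ} (hb : StrictAnti b)
    (i : Fin (m + 1)) : ∏ r, (b i - b (i.succAbove r)) ≠ 0 :=
  Finset.prod_ne_zero_iff.2 fun r _ => sub_succAbove_ne_zero hb i r

/-- The weights `γ i = T ∏ r, (b i - u r) / ∏_{j ≠ i} (b i - b j)` attached to the roots `u` and the
leading coefficient `T`, where `v = (u, T)`. -/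
def rootsToWeights {m : ℕ} (b v : Fin (m + 1) → ℝ) (i : Fin (m + 1)) : ℝ :=
  (v (Fin.last m) * ∏ r : Fin m, (b i - v r.castSucc)) / ∏ r, (b i - b (i.succAbove r))

/-- The pairs of a configuration interlacing with `b` and a positive number. -/
def interlacingCone {m : ℕ} (b : Fin (m + 1) → ℝ) : Set (Fin (m + 1) → ℝ) :=
  {v | Interlaces (fun r : Fin m => v r.castSucc) b ∧ 0 < v (Fin.last m)}

theorem rootsToWeights_pos {m : ℕ} {b : Fin (m + 1) → ℝ} (hb : StrictAnti b)
    {v : Fin (m + 1) → ℝ} (hv : v ∈ interlacingCone b) (i : Fin (m + 1)) :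
    0 < rootsToWeights b v i := by
  rw [rootsToWeights, mul_div_assoc, ← Finset.prod_div_distrib]
  refine mul_pos hv.2 (Finset.prod_pos fun r _ => ?_)
  rcases le_or_gt i r.castSucc with hi | hi
  · refine div_pos (sub_pos.2 (hv.1.lt_of_le hb hi)) (sub_pos.2 (hb ?_))
    rw [Fin.succAbove_of_le_castSucc _ _ hi]
    exact Fin.le_castSucc_iff.1 hi
  · refine div_pos_of_neg_of_neg (sub_neg.2 (hv.1.lt_of_lt hb hi)) (sub_neg.2 (hb ?_))
    rwa [Fin.succAbove_of_castSucc_lt _ _ hi]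

open Polynomial in
/-- The polynomial `∑ i, γ i ∏_{j ≠ i} (X - b j)`. -/
def weightsPoly {m : ℕ} (b γ : Fin (m + 1) → ℝ) : ℝ[X] :=
  ∑ i, C (γ i) * ∏ r : Fin m, (X - C (b (i.succAbove r)))

open Polynomial in
theorem eval_weightsPoly_node {m : ℕ} (b γ : Fin (m + 1) → ℝ) (i : Fin (m + 1)) :
    (weightsPoly b γ).eval (b i) = γ i * ∏ r, (b i - b (i.succAbove r)) := by
  rw [weightsPoly, eval_finsetSum, Finset.sum_eq_single i]
  · simp [eval_prod]
  · intro j _ hj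
    obtain ⟨r, hr⟩ := Fin.exists_succAbove_eq hj.symm
    simp only [eval_mul, eval_prod, eval_C, eval_sub, eval_X]
    rw [Finset.prod_eq_zero (Finset.mem_univ r) (by rw [hr, sub_self]), mul_zero]
  · simp

open Polynomial in
theorem natDegree_weightsPoly_le {m : ℕ} (b γ : Fin (m + 1) → ℝ) :
    (weightsPoly b γ).natDegree ≤ m := by
  refine natDegree_sum_le_of_forall_le _ _ fun i _ => (natDegree_C_mul_le _ _).trans ?_
  rw [natDegree_prod_of_monic _ _ fun s _ => monic_X_sub_C _]
  simp

open Polynomial in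
theorem coeff_prod_X_sub_C_card {m : ℕ} (u : Fin m → ℝ) :
    (∏ r : Fin m, (X - C (u r))).coeff m = 1 := by
  have hmonic : (∏ r : Fin m, (X - C (u r))).Monic :=
    monic_prod_of_monic _ _ fun s _ => monic_X_sub_C _
  have hdeg : (∏ r : Fin m, (X - C (u r))).natDegree = m := by
    rw [natDegree_prod_of_monic _ _ fun s _ => monic_X_sub_C _]
    simp
  have := hmonic.coeff_natDegree
  rwa [hdeg] at this

open Polynomial in
theorem natDegree_prod_X_sub_C_le {m : ℕ} (T : ℝ) (u : Fin m → ℝ) :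
    (C T * ∏ r : Fin m, (X - C (u r))).natDegree ≤ m := by
  refine (natDegree_C_mul_le _ _).trans ?_
  rw [natDegree_prod_of_monic _ _ fun s _ => monic_X_sub_C _]
  simp

open Polynomial in
theorem coeff_weightsPoly {m : ℕ} (b γ : Fin (m + 1) → ℝ) :
    (weightsPoly b γ).coeff m = ∑ i, γ i := by
  rw [weightsPoly, finsetSum_coeff]
  refine Finset.sum_congr rfl fun i _ => ?_
  rw [coeff_C_mul, coeff_prod_X_sub_C_card fun r => b (i.succAbove r), mul_one]

open Polynomial in
/-- Lagrange interpolation at the nodes `b`. -/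
theorem weightsPoly_rootsToWeights {m : ℕ} {b : Fin (m + 1) → ℝ} (hb : StrictAnti b)
    (v : Fin (m + 1) → ℝ) :
    weightsPoly b (rootsToWeights b v) =
      C (v (Fin.last m)) * ∏ r : Fin m, (X - C (v r.castSucc)) := by
  refine Polynomial.eq_of_degrees_lt_of_eval_index_eq (v := b) Finset.univ hb.injective.injOn
    ?_ ?_ fun i _ => ?_
  · refine degree_le_natDegree.trans_lt ?_
    rw [Finset.card_univ, Fintype.card_fin]
    exact_mod_cast Nat.lt_succ_of_le (natDegree_weightsPoly_le _ _)
  · refine degree_le_natDegree.trans_lt ?_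
    rw [Finset.card_univ, Fintype.card_fin]
    exact_mod_cast Nat.lt_succ_of_le (natDegree_prod_X_sub_C_le _ _)
  · rw [eval_weightsPoly_node, rootsToWeights,
      div_mul_cancel₀ _ (prod_sub_succAbove_ne_zero hb i)]
    simp [eval_prod]

theorem sum_rootsToWeights {m : ℕ} {b : Fin (m + 1) → ℝ} (hb : StrictAnti b)
    (v : Fin (m + 1) → ℝ) : ∑ i, rootsToWeights b v i = v (Fin.last m) := by
  rw [← coeff_weightsPoly b, weightsPoly_rootsToWeights hb, Polynomial.coeff_C_mul,
    coeff_prod_X_sub_C_card fun r : Fin m => v r.castSucc, mul_one]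

theorem sum_rootsToWeights_div {m : ℕ} {b : Fin (m + 1) → ℝ} (hb : StrictAnti b)
    (v : Fin (m + 1) → ℝ) {x : ℝ} (hx : ∀ i, x < b i) :
    ∑ i, rootsToWeights b v i / (b i - x) =
      v (Fin.last m) * (∏ r : Fin m, (v r.castSucc - x)) / ∏ i, (b i - x) := by
  have hne : ∀ i, b i - x ≠ 0 := fun i => (sub_pos.2 (hx i)).ne'
  have h := congrArg (Polynomial.eval x) (weightsPoly_rootsToWeights hb v)
  simp only [weightsPoly, Polynomial.eval_finsetSum, Polynomial.eval_mul, Polynomial.eval_C,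
    Polynomial.eval_prod, Polynomial.eval_sub, Polynomial.eval_X] at h
  have hneg : ∀ w : Fin m → ℝ, ∏ r, (x - w r) = (-1) ^ m * ∏ r, (w r - x) := by
    intro w
    have : ∀ r, x - w r = (-1) * (w r - x) := fun r => by ring
    simp_rw [this, Finset.prod_mul_distrib]
    simp
  simp_rw [hneg fun r => v r.castSucc] at h
  have hneg' : ∀ i : Fin (m + 1), ∏ r, (x - b (i.succAbove r)) = (-1) ^ m * ∏ r, (b (i.succAbove r) - x) :=
    fun i => hneg _
  simp_rw [hneg'] at h
  rw [eq_div_iff (Finset.prod_ne_zero_iff.2 fun i _ => hne i), Finset.sum_mul]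
  have hm : ((-1 : ℝ) ^ m) ≠ 0 := pow_ne_zero _ (by norm_num)
  refine mul_left_cancel₀ hm ?_
  rw [Finset.mul_sum, mul_left_comm, ← h]
  refine Finset.sum_congr rfl fun i _ => ?_
  rw [Fin.prod_univ_succAbove _ i]
  field_simp [hne i]

theorem injOn_rootsToWeights {m : ℕ} {b : Fin (m + 1) → ℝ} (hb : StrictAnti b) :
    Set.InjOn (rootsToWeights b) (interlacingCone b) := by
  intro v hv w hw h
  have hT : v (Fin.last m) = w (Fin.last m) := by
    rw [← sum_rootsToWeights hb v, h, sum_rootsToWeights hb]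
  have hP := (weightsPoly_rootsToWeights hb v).symm.trans
    ((congrArg (weightsPoly b) h).trans (weightsPoly_rootsToWeights hb w))
  funext j
  induction j using Fin.lastCases with
  | last => exact hT
  | cast r =>
    have h1 := congrArg (Polynomial.eval (v r.castSucc)) hP
    simp only [Polynomial.eval_mul, Polynomial.eval_C, Polynomial.eval_prod, Polynomial.eval_sub,
      Polynomial.eval_X] at h1
    rw [Finset.prod_eq_zero (Finset.mem_univ r) (sub_self _), mul_zero] at h1
    have h2 := (mul_eq_zero.1 h1.symm).resolve_left hw.2.ne'
    obtain ⟨s, -, hs⟩ := Finset.prod_eq_zero_iff.1 h2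
    have hs' : v r.castSucc = w s.castSucc := sub_eq_zero.1 hs
    have hrs : r = s := by
      rcases lt_trichotomy r s with hlt | heq | hgt
      · have h3 : b r.succ < v r.castSucc := (hv.1 r).2
        have h4 : w s.castSucc < b r.succ :=
          hw.1.lt_of_le hb (r := s) (Fin.succ_le_castSucc_iff.2 hlt)
        linarith
      · exact heq
      · have h3 : b s.succ < w s.castSucc := (hw.1 s).2
        have h4 : v r.castSucc < b s.succ :=
          hv.1.lt_of_le hb (r := r) (Fin.succ_le_castSucc_iff.2 hgt)
        linarith
    rw [hs', hrs]

theorem prod_sub_succAbove_mul_neg {m : ℕ} {b : Fin (m + 1) → ℝ} (hb : StrictAnti b) (r : Fin m) :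
    (∏ s, (b r.castSucc - b (r.castSucc.succAbove s))) *
      ∏ s, (b r.succ - b (r.succ.succAbove s)) < 0 := by
  rw [← Finset.prod_mul_distrib, ← Finset.mul_prod_erase _ _ (Finset.mem_univ r)]
  refine mul_neg_of_neg_of_pos ?_ (Finset.prod_pos fun s hs => ?_)
  · rw [Fin.succAbove_castSucc_self, Fin.succAbove_succ_self]
    have : b r.succ < b r.castSucc := hb Fin.castSucc_lt_succ
    nlinarith
  · rcases lt_or_gt_of_ne (Finset.ne_of_mem_erase hs) with h | h
    · rw [Fin.succAbove_castSucc_of_lt _ _ h, Fin.succAbove_succ_of_le _ _ h.le]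
      refine mul_pos_of_neg_of_neg (sub_neg.2 (hb ?_)) (sub_neg.2 (hb ?_))
      · exact Fin.castSucc_lt_castSucc_iff.2 h
      · exact (Fin.castSucc_lt_castSucc_iff.2 h).trans Fin.castSucc_lt_succ
    · rw [Fin.succAbove_castSucc_of_le _ _ h.le, Fin.succAbove_succ_of_lt _ _ h]
      refine mul_pos (sub_pos.2 (hb ?_)) (sub_pos.2 (hb ?_))
      · exact Fin.castSucc_lt_succ.trans (Fin.succ_lt_succ_iff.2 h)
      · exact Fin.succ_lt_succ_iff.2 h

open Polynomial in
theorem image_rootsToWeights {m : ℕ} {b : Fin (m + 1) → ℝ} (hb : StrictAnti b) :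
    rootsToWeights b '' interlacingCone b = {γ | ∀ i, 0 < γ i} := by
  refine Set.Subset.antisymm ?_ fun γ hγ => ?_
  · rintro _ ⟨v, hv, rfl⟩
    exact rootsToWeights_pos hb hv
  have hγ' : ∀ i, 0 < γ i := hγ
  have hroot : ∀ r : Fin m, ∃ x, (x < b r.castSucc ∧ b r.succ < x) ∧
      (weightsPoly b γ).eval x = 0 := by
    intro r
    have hprod : (weightsPoly b γ).eval (b r.castSucc) * (weightsPoly b γ).eval (b r.succ) < 0 := by
      rw [eval_weightsPoly_node, eval_weightsPoly_node]
      have := mul_neg_of_pos_of_neg (mul_pos (hγ' r.castSucc) (hγ' r.succ))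
        (prod_sub_succAbove_mul_neg hb r)
      linarith
    have hle : b r.succ ≤ b r.castSucc := (hb Fin.castSucc_lt_succ).le
    have hc : ContinuousOn (fun x => (weightsPoly b γ).eval x)
      (Set.Icc (b r.succ) (b r.castSucc)) := (weightsPoly b γ).continuous.continuousOn
    rcases mul_neg_iff.1 hprod with h | h
    · obtain ⟨x, hx, hx0⟩ := intermediate_value_Ioo hle hc (show (0 : ℝ) ∈ _ from ⟨h.2, h.1⟩)
      exact ⟨x, ⟨hx.2, hx.1⟩, hx0⟩
    · obtain ⟨x, hx, hx0⟩ := intermediate_value_Ioo' hle hc (show (0 : ℝ) ∈ _ from ⟨h.1, h.2⟩)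
      exact ⟨x, ⟨hx.2, hx.1⟩, hx0⟩
  choose u hu hu0 using hroot
  have hintegrable : Interlaces u b := hu
  set T := ∑ i, γ i with hT
  have hTpos : 0 < T := Finset.sum_pos (fun i _ => hγ' i) Finset.univ_nonempty
  have hP : weightsPoly b γ = C T * ∏ r : Fin m, (X - C (u r)) := by
    rw [← sub_eq_zero]
    refine Polynomial.eq_zero_of_degree_lt_of_eval_index_eq_zero (v := u) Finset.univ
      (hintegrable.strictAnti hb).injective.injOn ?_ fun r _ => ?_
    · rw [Finset.card_univ, Fintype.card_fin, degree_lt_iff_coeff_zero]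
      intro k hk
      rcases hk.eq_or_lt with rfl | hk
      · rw [coeff_sub, coeff_weightsPoly, coeff_C_mul, coeff_prod_X_sub_C_card, mul_one, sub_self]
      · rw [coeff_sub, coeff_eq_zero_of_natDegree_lt ((natDegree_weightsPoly_le _ _).trans_lt hk),
          coeff_eq_zero_of_natDegree_lt ((natDegree_prod_X_sub_C_le _ _).trans_lt hk), sub_self]
    · rw [eval_sub, hu0, eval_mul, eval_prod,
        Finset.prod_eq_zero (Finset.mem_univ r) (by simp), mul_zero, sub_self]
  refine ⟨Fin.snoc u T, ⟨by simpa using hintegrable, by simpa using hTpos⟩, funext fun i => ?_⟩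
  rw [rootsToWeights, div_eq_iff (prod_sub_succAbove_ne_zero hb i), ← eval_weightsPoly_node, hP]
  simp [eval_prod]

/-- The Jacobian matrix of `rootsToWeights`. -/
def rootsToWeightsJacobian {m : ℕ} (b v : Fin (m + 1) → ℝ) :
    Matrix (Fin (m + 1)) (Fin (m + 1)) ℝ :=
  Matrix.of fun i j => (∏ r, (b i - b (i.succAbove r)))⁻¹ *
    ((Fin.snoc (fun _ => -v (Fin.last m)) 1 : Fin (m + 1) → ℝ) j *
      (Fin.snoc (fun r => ∏ s ∈ Finset.univ.erase r, (b i - v s.castSucc))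
        (∏ s : Fin m, (b i - v s.castSucc)) : Fin (m + 1) → ℝ) j)

theorem hasFDerivAt_rootsToWeights {m : ℕ} (b v : Fin (m + 1) → ℝ) :
    HasFDerivAt (rootsToWeights b)
      (LinearMap.toContinuousLinearMap (Matrix.toLin' (rootsToWeightsJacobian b v))) v := by
  rw [hasFDerivAt_pi']
  intro i
  have h1 : ∀ r ∈ (Finset.univ : Finset (Fin m)), HasFDerivAt
      (fun w : Fin (m + 1) → ℝ => b i - w r.castSucc)
      (-(ContinuousLinearMap.proj r.castSucc : (Fin (m + 1) → ℝ) →L[ℝ] ℝ)) v := fun r _ =>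
    (hasFDerivAt_apply (𝕜 := ℝ) r.castSucc v).const_sub (b i)
  have h2 := ((hasFDerivAt_apply (𝕜 := ℝ) (Fin.last m) v).mul
    (HasFDerivAt.finsetProd h1)).mul_const (∏ r, (b i - b (i.succAbove r)))⁻¹
  refine HasFDerivAt.congr_fderiv h2 ?_
  ext w
  simp only [_root_.smul_apply, _root_.add_apply,
    _root_.sum_apply, _root_.neg_apply, ContinuousLinearMap.proj_apply,
    ContinuousLinearMap.comp_apply, LinearMap.coe_toContinuousLinearMap', Matrix.toLin'_apply,
    Matrix.mulVec, dotProduct, rootsToWeightsJacobian, Matrix.of_apply, Fin.sum_univ_castSucc,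
    Fin.snoc_castSucc, Fin.snoc_last, smul_eq_mul]
  rw [mul_add, Finset.mul_sum, Finset.mul_sum]
  refine congrArg₂ _ (Finset.sum_congr rfl fun r _ => ?_) ?_ <;> ring

theorem abs_det_rootsToWeightsJacobian {m : ℕ} {b : Fin (m + 1) → ℝ} (hb : StrictAnti b)
    {v : Fin (m + 1) → ℝ} (hv : v ∈ interlacingCone b) :
    |(rootsToWeightsJacobian b v).det| =
      v (Fin.last m) ^ m * absVdm (fun r : Fin m => v r.castSucc) / absVdm b := by
  rw [rootsToWeightsJacobian]
  have h1 := Matrix.det_mul_column (fun i => (∏ r, (b i - b (i.succAbove r)))⁻¹)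
    (Matrix.of fun i j : Fin (m + 1) => ((Fin.snoc (fun _ => -v (Fin.last m)) 1 : Fin (m + 1) → ℝ) j *
      (Fin.snoc (fun r => ∏ s ∈ Finset.univ.erase r, (b i - v s.castSucc))
        (∏ s : Fin m, (b i - v s.castSucc)) : Fin (m + 1) → ℝ) j))
  have h2 := Matrix.det_mul_row (Fin.snoc (fun _ => -v (Fin.last m)) 1 : Fin (m + 1) → ℝ)
    (Matrix.of fun i j : Fin (m + 1) =>
      (Fin.snoc (fun r => ∏ s ∈ Finset.univ.erase r, (b i - v s.castSucc))
        (∏ s : Fin m, (b i - v s.castSucc)) : Fin (m + 1) → ℝ) j)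
  simp only [Matrix.of_apply] at h1 h2
  rw [h1, h2, abs_mul, abs_mul, abs_det_prod_sub (u := fun r => v r.castSucc)
    (hv.1.strictAnti hb).injective fun r => (hv.1.lt_of_le hb (Fin.zero_le _)).ne]
  simp only [Finset.abs_prod, abs_inv, Finset.prod_inv_distrib, prod_abs_sub_succAbove]
  have hpos : 0 < absVdm b := absVdm_pos hb.injective
  rw [Fin.prod_univ_castSucc]
  simp only [Fin.snoc_castSucc, Fin.snoc_last, abs_neg, abs_of_pos hv.2, abs_one, mul_one,
    Finset.prod_const, Finset.card_univ, Fintype.card_fin]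
  field_simp

theorem lintegral_rpow_mul_exp_neg_mul_Ioi {s c : ℝ} (hs : 0 < s) (hc : 0 < c) :
    ∫⁻ t in Set.Ioi (0 : ℝ), ENNReal.ofReal (t ^ (s - 1) * Real.exp (-(c * t))) =
      ENNReal.ofReal (Real.Gamma s * c ^ (-s)) := by
  have h := Real.integral_rpow_mul_exp_neg_mul_Ioi hs hc
  have hG := Real.Gamma_pos_of_pos hs
  rw [← ofReal_integral_eq_lintegral_ofReal, h, Real.rpow_neg hc.le, one_div,
    Real.inv_rpow hc.le, mul_comm]
  · refine Integrable.of_integral_ne_zero (h.trans_ne ?_)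
    positivity
  · filter_upwards [self_mem_ae_restrict measurableSet_Ioi] with t ht
    have : (0 : ℝ) < t := ht
    simp only [Pi.zero_apply]
    positivity

theorem lintegral_prod_rpow_mul_exp_neg_mul {ι : Type*} [Fintype ι] {s : ℝ} (hs : 0 < s)
    {c : ι → ℝ} (hc : ∀ i, 0 < c i) :
    ∫⁻ γ in {γ : ι → ℝ | ∀ i, 0 < γ i},
        ENNReal.ofReal (∏ i, (γ i ^ (s - 1) * Real.exp (-(c i * γ i)))) =
      ENNReal.ofReal (Real.Gamma s ^ Fintype.card ι * ∏ i, c i ^ (-s)) := by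
  have hG := Real.Gamma_pos_of_pos hs
  have hset : {γ : ι → ℝ | ∀ i, 0 < γ i} = Set.univ.pi fun _ => Set.Ioi 0 := by
    ext γ
    simp
  have h1 : ∀ i, ∫ t in Set.Ioi (0 : ℝ), t ^ (s - 1) * Real.exp (-(c i * t)) =
      Real.Gamma s * c i ^ (-s) := fun i => by
    rw [Real.integral_rpow_mul_exp_neg_mul_Ioi hs (hc i), Real.rpow_neg (hc i).le, one_div,
      Real.inv_rpow (hc i).le, mul_comm]
  have hintegrable : ∀ i, Integrable (fun t : ℝ => t ^ (s - 1) * Real.exp (-(c i * t)))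
      (volume.restrict (Set.Ioi 0)) := fun i => by
    refine Integrable.of_integral_ne_zero ((h1 i).trans_ne ?_)
    have := hc i
    positivity
  have hr : (volume : Measure (ι → ℝ)).restrict {γ : ι → ℝ | ∀ i, 0 < γ i} =
      Measure.pi fun _ => volume.restrict (Set.Ioi 0) := by
    rw [hset, volume_pi, Measure.restrict_pi_pi]
  rw [← ofReal_integral_eq_lintegral_ofReal]
  · rw [hr, integral_fintype_prod_eq_prod fun i (t : ℝ) => t ^ (s - 1) * Real.exp (-(c i * t))]
    simp_rw [h1, Finset.prod_mul_distrib]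
    simp
  · rw [hr]
    exact Integrable.fintype_prod hintegrable
  · filter_upwards [self_mem_ae_restrict
      (hset ▸ MeasurableSet.univ_pi fun _ => measurableSet_Ioi)] with γ hγ
    exact Finset.prod_nonneg fun i _ => mul_nonneg (Real.rpow_nonneg (hγ i).le _)
      (Real.exp_nonneg _)

theorem lintegral_prod_gamma_mul_sum_rpow {ι : Type*} [Fintype ι] [Nonempty ι] {θ : ℝ}
    (hθ : 0 < θ) {c : ι → ℝ} (hc : ∀ i, 0 < c i) :
    ENNReal.ofReal (Real.Gamma θ) * ∫⁻ γ in {γ : ι → ℝ | ∀ i, 0 < γ i},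
        ENNReal.ofReal ((∏ i, (γ i ^ (θ - 1) * Real.exp (-γ i))) * (∑ i, γ i * c i) ^ (-θ)) =
      ENNReal.ofReal (Real.Gamma θ ^ Fintype.card ι) *
        ∫⁻ t in Set.Ioi (0 : ℝ), ENNReal.ofReal (t ^ (θ - 1) * ∏ i, (1 + t * c i) ^ (-θ)) := by
  have hG := Real.Gamma_pos_of_pos hθ
  have hset : MeasurableSet {γ : ι → ℝ | ∀ i, 0 < γ i} := by
    have : {γ : ι → ℝ | ∀ i, 0 < γ i} = Set.univ.pi fun _ => Set.Ioi 0 := by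
      ext γ
      simp
    rw [this]
    exact MeasurableSet.univ_pi fun _ => measurableSet_Ioi
  rw [← lintegral_const_mul' _ _ ENNReal.ofReal_ne_top,
    ← lintegral_const_mul' _ _ ENNReal.ofReal_ne_top]
  have h1 : ∀ γ ∈ {γ : ι → ℝ | ∀ i, 0 < γ i},
      ENNReal.ofReal (Real.Gamma θ) *
        ENNReal.ofReal ((∏ i, (γ i ^ (θ - 1) * Real.exp (-γ i))) * (∑ i, γ i * c i) ^ (-θ)) =
      ∫⁻ t in Set.Ioi (0 : ℝ), ENNReal.ofReal ((∏ i, (γ i ^ (θ - 1) * Real.exp (-γ i))) *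
        (t ^ (θ - 1) * Real.exp (-((∑ i, γ i * c i) * t)))) := by
    intro γ hγ
    have hS : 0 < ∑ i, γ i * c i :=
      Finset.sum_pos (fun i _ => mul_pos (hγ i) (hc i)) Finset.univ_nonempty
    have hA : 0 ≤ ∏ i, (γ i ^ (θ - 1) * Real.exp (-γ i)) :=
      Finset.prod_nonneg fun i _ => mul_nonneg (Real.rpow_nonneg (hγ i).le _) (Real.exp_nonneg _)
    simp_rw [ENNReal.ofReal_mul hA]
    rw [lintegral_const_mul' _ _ ENNReal.ofReal_ne_top, lintegral_rpow_mul_exp_neg_mul_Ioi hθ hS,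
      ENNReal.ofReal_mul hG.le]
    ring
  rw [setLIntegral_congr_fun hset h1, lintegral_lintegral_swap]
  · refine setLIntegral_congr_fun measurableSet_Ioi fun t ht => ?_
    have ht' : (0 : ℝ) < t := ht
    have hpos : ∀ i, 0 < 1 + t * c i := fun i => by
      have := mul_pos ht' (hc i)
      linarith
    have h2 : ∀ γ : ι → ℝ, ENNReal.ofReal ((∏ i, (γ i ^ (θ - 1) * Real.exp (-γ i))) *
        (t ^ (θ - 1) * Real.exp (-((∑ i, γ i * c i) * t)))) = ENNReal.ofReal (t ^ (θ - 1)) *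
        ENNReal.ofReal (∏ i, (γ i ^ (θ - 1) * Real.exp (-((1 + t * c i) * γ i)))) := by
      intro γ
      rw [← ENNReal.ofReal_mul (by positivity)]
      congr 1
      have : Real.exp (-((∑ i, γ i * c i) * t)) = ∏ i, Real.exp (-(γ i * c i * t)) := by
        rw [← Real.exp_sum, Finset.sum_neg_distrib, Finset.sum_mul]
      rw [this, mul_left_comm, ← Finset.prod_mul_distrib]
      congr 1
      refine Finset.prod_congr rfl fun i _ => ?_
      rw [mul_assoc, ← Real.exp_add]
      ring_nf
    simp_rw [h2]
    rw [lintegral_const_mul' _ _ ENNReal.ofReal_ne_top,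
      lintegral_prod_rpow_mul_exp_neg_mul hθ hpos, ENNReal.ofReal_mul (by positivity),
      ENNReal.ofReal_mul (by positivity)]
    ring
  · refine Measurable.aemeasurable ?_
    fun_prop

/-- The density `V(u) ∏ |b s - u r| ^ (θ - 1)` of the Dixon–Anderson measure. -/
def dixonDensity (θ : ℝ) {m : ℕ} (b : Fin (m + 1) → ℝ) (u : Fin m → ℝ) : ℝ :=
  absVdm u * ∏ s, ∏ r, |b s - u r| ^ (θ - 1)

theorem dixonDensity_nonneg (θ : ℝ) {m : ℕ} (b : Fin (m + 1) → ℝ) (u : Fin m → ℝ) :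
    0 ≤ dixonDensity θ b u :=
  mul_nonneg (absVdm_nonneg u) (Finset.prod_nonneg fun _ _ => Finset.prod_nonneg fun _ _ => by
    positivity)

@[fun_prop]
theorem measurable_absVdm {n : ℕ} : Measurable (absVdm : (Fin n → ℝ) → ℝ) := by
  unfold absVdm
  refine Finset.measurable_prod _ fun i _ => Finset.measurable_prod _ fun j _ => ?_
  split_ifs <;> fun_prop

@[fun_prop]
theorem measurable_dixonDensity (θ : ℝ) {m : ℕ} (b : Fin (m + 1) → ℝ) :
    Measurable (dixonDensity θ b) := by
  unfold dixonDensity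
  fun_prop

theorem measurableSet_interlaces {m : ℕ} (b : Fin (m + 1) → ℝ) :
    MeasurableSet {u : Fin m → ℝ | Interlaces u b} := by
  simp only [Interlaces, Set.ofPred_forall]
  refine MeasurableSet.iInter fun i => ?_
  exact (measurableSet_lt (measurable_pi_apply i) measurable_const).inter
    (measurableSet_lt measurable_const (measurable_pi_apply i))

theorem measurableSet_interlacingCone {m : ℕ} (b : Fin (m + 1) → ℝ) :
    MeasurableSet (interlacingCone b) := by
  have h : Measurable fun v : Fin (m + 1) → ℝ => fun r : Fin m => v r.castSucc := by fun_prop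
  exact (h (measurableSet_interlaces b)).inter
    (measurableSet_lt measurable_const (measurable_pi_apply _))

theorem prod_rootsToWeights {m : ℕ} {b : Fin (m + 1) → ℝ} (hb : StrictAnti b)
    {v : Fin (m + 1) → ℝ} (hv : v ∈ interlacingCone b) :
    ∏ i, rootsToWeights b v i = v (Fin.last m) ^ (m + 1) *
      (∏ s, ∏ r : Fin m, |b s - v r.castSucc|) / absVdm b ^ 2 := by
  rw [← abs_of_pos (Finset.prod_pos fun i _ => rootsToWeights_pos hb hv i), Finset.abs_prod]
  simp_rw [rootsToWeights, abs_div, abs_mul, Finset.abs_prod, abs_of_pos hv.2]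
  rw [Finset.prod_div_distrib, Finset.prod_mul_distrib, prod_abs_sub_succAbove]
  simp

theorem jacobian_mul_weights {θ : ℝ} {m : ℕ} {b : Fin (m + 1) → ℝ}
    (hb : StrictAnti b) {x : ℝ} (hx : ∀ i, x < b i) {v : Fin (m + 1) → ℝ}
    (hv : v ∈ interlacingCone b) :
    |(rootsToWeightsJacobian b v).det| *
      ((∏ i, (rootsToWeights b v i ^ (θ - 1) * Real.exp (-rootsToWeights b v i))) *
        (∑ i, rootsToWeights b v i * (b i - x)⁻¹) ^ (-θ)) =
    (absVdm b ^ (1 - 2 * θ) * (∏ i, (b i - x)) ^ θ) *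
      ((dixonDensity θ b (fun r : Fin m => v r.castSucc) *
        (∏ r : Fin m, (v r.castSucc - x)) ^ (-θ)) *
      (v (Fin.last m) ^ (m * θ - 1) * Real.exp (-(1 * v (Fin.last m))))) := by
  have hT : 0 < v (Fin.last m) := hv.2
  have hV : 0 < absVdm b := absVdm_pos hb.injective
  have hu : ∀ r : Fin m, 0 < v r.castSucc - x := fun r =>
    sub_pos.2 ((hx (r.succ)).trans (hv.1 r).2)
  have hU : 0 < ∏ r : Fin m, (v r.castSucc - x) := Finset.prod_pos fun r _ => hu r
  have hB : 0 < ∏ i, (b i - x) := Finset.prod_pos fun i _ => sub_pos.2 (hx i)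
  have hP : 0 < ∏ s, ∏ r : Fin m, |b s - v r.castSucc| := Finset.prod_pos fun s _ =>
    Finset.prod_pos fun r _ => abs_pos.2 (hv.1.sub_ne_zero hb s r)
  rw [abs_det_rootsToWeightsJacobian hb hv, Finset.prod_mul_distrib,
    Real.finsetProd_rpow _ _ fun i _ => (rootsToWeights_pos hb hv i).le, ← Real.exp_sum,
    Finset.sum_neg_distrib, sum_rootsToWeights hb, prod_rootsToWeights hb hv]
  simp_rw [← div_eq_mul_inv]
  rw [sum_rootsToWeights_div hb v hx, dixonDensity]
  have hP' : ∏ s, ∏ r : Fin m, |b s - v r.castSucc| ^ (θ - 1) =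
      (∏ s, ∏ r : Fin m, |b s - v r.castSucc|) ^ (θ - 1) := by
    rw [← Real.finsetProd_rpow _ _ fun s _ => Finset.prod_nonneg fun r _ => abs_nonneg _]
    refine Finset.prod_congr rfl fun s _ => ?_
    rw [← Real.finsetProd_rpow _ _ fun r _ => abs_nonneg _]
  rw [hP', Real.div_rpow (by positivity) (by positivity), Real.mul_rpow (by positivity) hP.le,
    Real.div_rpow (by positivity) hB.le, Real.mul_rpow hT.le hU.le, ← Real.rpow_natCast,
    ← Real.rpow_natCast, ← Real.rpow_natCast, ← Real.rpow_mul hT.le, ← Real.rpow_mul hV.le,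
    Real.rpow_neg hB.le]
  have e1 : v (Fin.last m) ^ ((m : ℝ) * θ - 1) = v (Fin.last m) ^ (m : ℝ) *
      v (Fin.last m) ^ (((m + 1 : ℕ) : ℝ) * (θ - 1)) * v (Fin.last m) ^ (-θ) := by
    rw [← Real.rpow_add hT, ← Real.rpow_add hT]
    congr 1
    push_cast
    ring
  have e2 : absVdm b ^ (1 - 2 * θ) = (absVdm b)⁻¹ * (absVdm b ^ (((2 : ℕ) : ℝ) * (θ - 1)))⁻¹ := by
    rw [← Real.rpow_neg hV.le, ← Real.rpow_neg_one, ← Real.rpow_add hV]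
    congr 1
    push_cast
    ring
  rw [e1, e2, one_mul]
  have hBθ : 0 < (∏ i, (b i - x)) ^ θ := Real.rpow_pos_of_pos hB _
  field_simp

/-- The Dixon–Anderson integral. -/
theorem lintegral_dixonDensity {θ : ℝ} (hθ : 0 < θ) {m : ℕ} (hm : 0 < m) {b : Fin (m + 1) → ℝ}
    (hb : StrictAnti b) {x : ℝ} (hx : ∀ i, x < b i) :
    ENNReal.ofReal (Real.Gamma (m * θ) * absVdm b ^ (1 - 2 * θ)) *
      ∫⁻ u in {u : Fin m → ℝ | Interlaces u b},
        ENNReal.ofReal (dixonDensity θ b u * (∏ r, (u r - x)) ^ (-θ)) =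
    ENNReal.ofReal (Real.Gamma θ ^ m) *
      ∫⁻ t in Set.Ioi (0 : ℝ), ENNReal.ofReal (t ^ (θ - 1) * ∏ i, (b i - x + t) ^ (-θ)) := by
  have hG := Real.Gamma_pos_of_pos hθ
  have hmθ : 0 < m * θ := by positivity
  have hGm := Real.Gamma_pos_of_pos hmθ
  have hV : 0 < absVdm b := absVdm_pos hb.injective
  have hbx : ∀ i, 0 < b i - x := fun i => sub_pos.2 (hx i)
  have hB : 0 < ∏ i, (b i - x) := Finset.prod_pos fun i _ => hbx i
  have hBθ : 0 < (∏ i, (b i - x)) ^ θ := Real.rpow_pos_of_pos hB _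
  have key := lintegral_prod_gamma_mul_sum_rpow hθ fun i => inv_pos.2 (hbx i)
  rw [← image_rootsToWeights hb, lintegral_image_eq_lintegral_abs_det_fderiv_mul volume
    (measurableSet_interlacingCone b)
    (fun v _ => (hasFDerivAt_rootsToWeights b v).hasFDerivWithinAt) (injOn_rootsToWeights hb)] at key
  have h1 : ∀ v ∈ interlacingCone b, ENNReal.ofReal |(LinearMap.toContinuousLinearMap
        (Matrix.toLin' (rootsToWeightsJacobian b v))).det| *
      ENNReal.ofReal ((∏ i, (rootsToWeights b v i ^ (θ - 1) * Real.exp (-rootsToWeights b v i))) *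
        (∑ i, rootsToWeights b v i * (b i - x)⁻¹) ^ (-θ)) =
    ENNReal.ofReal (absVdm b ^ (1 - 2 * θ) * (∏ i, (b i - x)) ^ θ) *
      (ENNReal.ofReal (dixonDensity θ b (fun r : Fin m => v r.castSucc) *
        (∏ r : Fin m, (v r.castSucc - x)) ^ (-θ)) *
      ENNReal.ofReal (v (Fin.last m) ^ (m * θ - 1) * Real.exp (-(1 * v (Fin.last m))))) := by
    intro v hv
    have hU : 0 ≤ ∏ r : Fin m, (v r.castSucc - x) := Finset.prod_nonneg fun r _ =>
      (sub_pos.2 ((hx (r.succ)).trans (hv.1 r).2)).le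
    have hdet : (LinearMap.toContinuousLinearMap
        (Matrix.toLin' (rootsToWeightsJacobian b v))).det = (rootsToWeightsJacobian b v).det := by
      simp [ContinuousLinearMap.det]
    rw [hdet, ← ENNReal.ofReal_mul (abs_nonneg _), jacobian_mul_weights hb hx hv,
      ENNReal.ofReal_mul (by positivity), ENNReal.ofReal_mul
      (mul_nonneg (dixonDensity_nonneg _ _ _) (Real.rpow_nonneg hU _))]
  rw [setLIntegral_congr_fun (measurableSet_interlacingCone b) h1,
    lintegral_const_mul' _ _ ENNReal.ofReal_ne_top] at key
  have hpre : (fun p : (Fin m → ℝ) × ℝ => (Fin.snoc p.1 p.2 : Fin (m + 1) → ℝ)) ⁻¹'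
      interlacingCone b = {u : Fin m → ℝ | Interlaces u b} ×ˢ Set.Ioi (0 : ℝ) := by
    ext p
    simp [interlacingCone]
  rw [← (measurePreserving_finSnoc (n := m) (α := fun _ => ℝ)).setLIntegral_comp_preimage_emb
    (measurableEmbedding_finSnoc (n := m) (α := fun _ => ℝ)), hpre] at key
  simp only [Fin.snoc_castSucc, Fin.snoc_last] at key
  rw [Measure.volume_eq_prod, ← Measure.prod_restrict, lintegral_prod_mul
    (f := fun u => ENNReal.ofReal (dixonDensity θ b u * (∏ r : Fin m, (u r - x)) ^ (-θ)))
    (g := fun T => ENNReal.ofReal (T ^ (m * θ - 1) * Real.exp (-(1 * T))))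
    (by fun_prop) (by fun_prop), lintegral_rpow_mul_exp_neg_mul_Ioi hmθ one_pos,
    Real.one_rpow, mul_one] at key
  have h2 : ∀ t ∈ Set.Ioi (0 : ℝ), ENNReal.ofReal (t ^ (θ - 1) * ∏ i, (1 + t * (b i - x)⁻¹) ^ (-θ))
      = ENNReal.ofReal ((∏ i, (b i - x)) ^ θ) *
        ENNReal.ofReal (t ^ (θ - 1) * ∏ i, (b i - x + t) ^ (-θ)) := by
    intro t ht
    have ht' : (0 : ℝ) < t := ht
    rw [← ENNReal.ofReal_mul hBθ.le, ← Real.finsetProd_rpow _ _ fun i _ => (hbx i).le,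
      mul_left_comm, ← Finset.prod_mul_distrib]
    congr 2
    refine Finset.prod_congr rfl fun i _ => ?_
    have hi := hbx i
    have : 1 + t * (b i - x)⁻¹ = (b i - x + t) / (b i - x) := by field_simp
    rw [this, Real.div_rpow (by positivity) hi.le, Real.rpow_neg hi.le, div_inv_eq_mul, mul_comm]
  rw [setLIntegral_congr_fun measurableSet_Ioi h2, lintegral_const_mul' _ _ ENNReal.ofReal_ne_top,
    Fintype.card_fin, pow_succ, ENNReal.ofReal_mul (Real.rpow_nonneg hV.le _),
    ENNReal.ofReal_mul (pow_nonneg hG.le m)] at key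
  rw [ENNReal.ofReal_mul hGm.le]
  have hc0 : ENNReal.ofReal (Real.Gamma θ) * ENNReal.ofReal ((∏ i, (b i - x)) ^ θ) ≠ 0 := by
    simp [hG, hBθ]
  refine (ENNReal.mul_right_inj hc0 (by finiteness)).1 ?_
  calc _ = _ := by ring
    _ = _ := key
    _ = _ := by ring

/-- The product `∏ (a i - z) ^ (-θ)` of principal powers. -/
def branchProd (θ : ℝ) {N : ℕ} (a : Fin N → ℝ) (z : ℂ) : ℂ :=
  ∏ i : Fin N, Complex.exp (-(θ : ℂ) * Complex.log ((a i : ℂ) - z))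

theorem norm_exp_neg_mul_log (θ : ℝ) {w : ℂ} (hw : w ≠ 0) :
    ‖Complex.exp (-(θ : ℂ) * Complex.log w)‖ = ‖w‖ ^ (-θ) := by
  rw [Complex.norm_exp, Real.rpow_def_of_pos (norm_pos_iff.2 hw), ← Complex.ofReal_neg,
    Complex.re_ofReal_mul, Complex.log_re, mul_comm]

theorem exp_neg_mul_log_ofReal (θ : ℝ) {w : ℝ} (hw : 0 < w) :
    Complex.exp (-(θ : ℂ) * Complex.log w) = ((w ^ (-θ) : ℝ) : ℂ) := by
  rw [← Complex.ofReal_log hw.le, Real.rpow_def_of_pos hw]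
  push_cast
  ring_nf

theorem branchProd_ofReal (θ : ℝ) {N : ℕ} {a : Fin N → ℝ} {x : ℝ} (hx : ∀ i, x < a i) :
    branchProd θ a x = ((∏ i, (a i - x) ^ (-θ) : ℝ) : ℂ) := by
  rw [branchProd, Complex.ofReal_prod]
  refine Finset.prod_congr rfl fun i _ => ?_
  rw [← exp_neg_mul_log_ofReal θ (sub_pos.2 (hx i)), Complex.ofReal_sub]

theorem ofReal_sub_mem_slitPlane_of_le {β x : ℝ} (hx : β ≤ x) {z : ℂ}
    (hz : (β : ℂ) - z ∈ Complex.slitPlane) : (x : ℂ) - z ∈ Complex.slitPlane := by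
  rw [Complex.mem_slitPlane_iff] at hz ⊢
  simp only [Complex.sub_re, Complex.ofReal_re, Complex.sub_im, Complex.ofReal_im] at hz ⊢
  rcases hz with h | h
  · exact Or.inl (by linarith)
  · exact Or.inr h

theorem differentiableAt_branchProd (θ : ℝ) {N : ℕ} {a : Fin N → ℝ} {β : ℝ} (ha : ∀ i, β ≤ a i)
    {z : ℂ} (hz : (β : ℂ) - z ∈ Complex.slitPlane) : DifferentiableAt ℂ (branchProd θ a) z := by
  unfold branchProd
  refine DifferentiableAt.fun_finsetProd fun i _ => ?_
  exact (((differentiableAt_const _).sub differentiableAt_id).clog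
    (ofReal_sub_mem_slitPlane_of_le (ha i) hz)).const_mul _ |>.cexp

theorem sub_sub_ofReal_mem_slitPlane {β t : ℝ} (ht : 0 ≤ t) {z : ℂ}
    (hz : (β : ℂ) - z ∈ Complex.slitPlane) : (β : ℂ) - (z - t) ∈ Complex.slitPlane := by
  have := ofReal_sub_mem_slitPlane_of_le (le_add_of_nonneg_right ht) hz
  push_cast at this
  convert this using 1
  ring

/-- `z` has distance at least `δ` from the ray `[β, ∞)`. -/
def FarFromRay (β δ : ℝ) (z : ℂ) : Prop := ∀ x : ℝ, β ≤ x → δ ≤ ‖(x : ℂ) - z‖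

theorem exists_ball_farFromRay {β : ℝ} {z₀ : ℂ} (hz : (β : ℂ) - z₀ ∈ Complex.slitPlane) :
    ∃ δ > 0, ∀ z ∈ Metric.ball z₀ δ, FarFromRay β δ z := by
  have hopen : IsOpen {z : ℂ | (β : ℂ) - z ∈ Complex.slitPlane} :=
    Complex.isOpen_slitPlane.preimage (by fun_prop)
  obtain ⟨ε, hε, hball⟩ := Metric.isOpen_iff.1 hopen z₀ hz
  refine ⟨ε / 2, by positivity, fun z hz x hx => ?_⟩
  by_contra! hlt
  have hmem : (x : ℂ) ∈ Metric.ball z₀ ε := by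
    rw [Metric.mem_ball, dist_eq_norm]
    have h1 : ‖z - z₀‖ < ε / 2 := by simpa [dist_eq_norm] using hz
    calc ‖(x : ℂ) - z₀‖ = ‖((x : ℂ) - z) + (z - z₀)‖ := by ring_nf
      _ ≤ ‖(x : ℂ) - z‖ + ‖z - z₀‖ := norm_add_le _ _
      _ < ε := by linarith
  have h2 : (x : ℂ) - x ∈ Complex.slitPlane := ofReal_sub_mem_slitPlane_of_le hx (hball hmem)
  simp at h2

theorem prod_le_pow_of_forall_le {n : ℕ} {f : Fin n → ℝ} {c : ℝ} (h0 : ∀ i, 0 ≤ f i)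
    (h : ∀ i, f i ≤ c) : ∏ i, f i ≤ c ^ n :=
  (Finset.prod_le_prod (fun i _ => h0 i) fun i _ => h i).trans_eq (by simp)

theorem norm_branchProd_le {θ : ℝ} (hθ : 0 < θ) {N : ℕ} {a : Fin N → ℝ} {β δ : ℝ} (hδ : 0 < δ)
    (ha : ∀ i, β ≤ a i) {z : ℂ} (hz : FarFromRay β δ z) :
    ‖branchProd θ a z‖ ≤ (δ ^ (-θ)) ^ N := by
  rw [branchProd, norm_prod]
  refine prod_le_pow_of_forall_le (fun i => norm_nonneg _) fun i => ?_
  have h := hz (a i) (ha i)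
  rw [norm_exp_neg_mul_log θ (norm_pos_iff.1 (hδ.trans_le h))]
  exact Real.rpow_le_rpow_of_nonpos hδ h (by linarith)

theorem exists_norm_branchProd_sub_le {θ : ℝ} (hθ : 0 < θ) {N : ℕ} {a : Fin N → ℝ} {β δ : ℝ}
    (hδ : 0 < δ) (ha : ∀ i, β ≤ a i) :
    ∃ A : ℝ, 0 ≤ A ∧ ∀ z : ℂ, FarFromRay β δ z → ∀ t : ℝ, 0 ≤ t →
      ‖branchProd θ a (z - t)‖ ≤ A * (1 + ‖z‖) ^ (N * θ) * (1 + t) ^ (-(N * θ)) := by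
  set K : Fin N → ℝ := fun i => 1 + (1 + |a i|) / δ with hK
  have hKpos : ∀ i, 0 < K i := fun i => by positivity
  refine ⟨∏ i, K i ^ θ, Finset.prod_nonneg fun i _ => Real.rpow_nonneg (hKpos i).le _,
    fun z hz t ht => ?_⟩
  have hz1 : 0 < 1 + ‖z‖ := by positivity
  have ht1 : 0 < 1 + t := by positivity
  have hR : (∏ i, K i ^ θ) * (1 + ‖z‖) ^ (N * θ) * (1 + t) ^ (-(N * θ)) =
      ∏ i : Fin N, (K i ^ θ * (1 + ‖z‖) ^ θ * (1 + t) ^ (-θ)) := by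
    rw [Finset.prod_mul_distrib, Finset.prod_mul_distrib, Finset.prod_const, Finset.prod_const,
      Finset.card_univ, Fintype.card_fin, ← Real.rpow_mul_natCast hz1.le,
      ← Real.rpow_mul_natCast ht1.le]
    ring_nf
  rw [hR, branchProd, norm_prod]
  refine Finset.prod_le_prod (fun i _ => norm_nonneg _) fun i _ => ?_
  have h : δ ≤ ‖(a i : ℂ) - (z - t)‖ := by
    have := hz (a i + t) (by linarith [ha i])
    push_cast at this
    convert this using 2
    ring
  set w := (a i : ℂ) - (z - t) with hw
  have hwpos : 0 < ‖w‖ := hδ.trans_le h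
  have hbound : 1 + t ≤ K i * (1 + ‖z‖) * ‖w‖ := by
    have h1 : t ≤ ‖w‖ + |a i| + ‖z‖ := by
      have : (t : ℂ) = w - a i + z := by rw [hw]; ring
      calc t = ‖(t : ℂ)‖ := by rw [Complex.norm_real, Real.norm_of_nonneg ht]
        _ = ‖w - a i + z‖ := by rw [this]
        _ ≤ ‖w - a i‖ + ‖z‖ := norm_add_le _ _
        _ ≤ ‖w‖ + ‖(a i : ℂ)‖ + ‖z‖ := by gcongr; exact norm_sub_le _ _
        _ = _ := by rw [Complex.norm_real, Real.norm_eq_abs]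
    have h2 : 1 ≤ ‖w‖ / δ := (one_le_div hδ).2 h
    have h3 : (1 + |a i| + ‖z‖) ≤ (1 + |a i| + ‖z‖) * (‖w‖ / δ) :=
      le_mul_of_one_le_right (by positivity) h2
    have h4 : K i * (1 + ‖z‖) * ‖w‖ = ‖w‖ + (1 + |a i| + ‖z‖) * (‖w‖ / δ) +
        (‖w‖ * ‖z‖ + |a i| * ‖z‖ * (‖w‖ / δ)) := by
      simp only [hK]
      field_simp
      ring
    have h5 : 0 ≤ ‖w‖ * ‖z‖ + |a i| * ‖z‖ * (‖w‖ / δ) := by positivity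
    linarith
  rw [norm_exp_neg_mul_log θ (norm_pos_iff.1 hwpos), Real.rpow_neg hwpos.le, Real.rpow_neg ht1.le,
    ← Real.mul_rpow (hKpos i).le hz1.le, ← div_eq_mul_inv, inv_eq_one_div,
    div_le_div_iff₀ (Real.rpow_pos_of_pos hwpos _) (Real.rpow_pos_of_pos ht1 _), one_mul,
    ← Real.mul_rpow (mul_pos (hKpos i) hz1).le hwpos.le]
  exact Real.rpow_le_rpow ht1.le hbound hθ.le

theorem integrableOn_rpow_mul_one_add_rpow {s q : ℝ} (hs : 0 < s) (hq : s < q) :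
    IntegrableOn (fun t : ℝ => t ^ (s - 1) * (1 + t) ^ (-q)) (Set.Ioi 0) := by
  have hmeas : Measurable fun t : ℝ => t ^ (s - 1) * (1 + t) ^ (-q) := by fun_prop
  rw [← Set.Ioc_union_Ioi_eq_Ioi (zero_le_one' ℝ)]
  refine IntegrableOn.union ?_ ?_
  · have h1 : IntegrableOn (fun t : ℝ => t ^ (s - 1)) (Set.Ioc 0 1) :=
      (intervalIntegrable_iff_integrableOn_Ioc_of_le zero_le_one).1
        (intervalIntegral.intervalIntegrable_rpow' (by linarith))
    refine Integrable.mono' h1 hmeas.aestronglyMeasurable ?_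
    filter_upwards [self_mem_ae_restrict measurableSet_Ioc] with t ht
    have ht0 : 0 < t := ht.1
    rw [Real.norm_of_nonneg (by positivity)]
    exact mul_le_of_le_one_right (by positivity)
      (Real.rpow_le_one_of_one_le_of_nonpos (by linarith) (by linarith))
  · have h1 : IntegrableOn (fun t : ℝ => t ^ (s - 1 - q)) (Set.Ioi 1) :=
      integrableOn_Ioi_rpow_of_lt (by linarith) one_pos
    refine Integrable.mono' h1 hmeas.aestronglyMeasurable ?_
    filter_upwards [self_mem_ae_restrict measurableSet_Ioi] with t ht
    have ht0 : 0 < t := one_pos.trans ht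
    rw [Real.norm_of_nonneg (by positivity), sub_eq_add_neg (s - 1), Real.rpow_add ht0]
    exact mul_le_mul_of_nonneg_left
      (Real.rpow_le_rpow_of_nonpos ht0 (by linarith) (by linarith)) (by positivity)

theorem Interlaces.last_lt {m : ℕ} {u : Fin m → ℝ} {b : Fin (m + 1) → ℝ} (hb : StrictAnti b)
    (h : Interlaces u b) (r : Fin m) : b (Fin.last m) < u r :=
  h.lt_of_lt hb (Fin.castSucc_lt_last r)

theorem integral_dixonDensity_real {θ : ℝ} (hθ : 0 < θ) {m : ℕ} (hm : 0 < m) {b : Fin (m + 1) → ℝ}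
    (hb : StrictAnti b) {x : ℝ} (hx : ∀ i, x < b i) :
    (Real.Gamma (m * θ) * absVdm b ^ (1 - 2 * θ)) *
      ∫ u in {u : Fin m → ℝ | Interlaces u b}, dixonDensity θ b u * (∏ r, (u r - x)) ^ (-θ) =
    Real.Gamma θ ^ m *
      ∫ t in Set.Ioi (0 : ℝ), t ^ (θ - 1) * ∏ i, (b i - x + t) ^ (-θ) := by
  have hG := Real.Gamma_pos_of_pos hθ
  have hGm := Real.Gamma_pos_of_pos (show 0 < m * θ by positivity)
  have hV : 0 < absVdm b := absVdm_pos hb.injective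
  have h := congrArg ENNReal.toReal (lintegral_dixonDensity hθ hm hb hx)
  rw [ENNReal.toReal_mul, ENNReal.toReal_mul, ENNReal.toReal_ofReal (by positivity),
    ENNReal.toReal_ofReal (by positivity)] at h
  rw [integral_eq_lintegral_of_nonneg_ae, integral_eq_lintegral_of_nonneg_ae, h]
  · filter_upwards [self_mem_ae_restrict measurableSet_Ioi] with t ht
    have ht0 : (0 : ℝ) < t := ht
    refine mul_nonneg (by positivity) (Finset.prod_nonneg fun i _ => Real.rpow_nonneg ?_ _)
    linarith [hx i]
  · exact Measurable.aestronglyMeasurable (by fun_prop)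
  · filter_upwards [self_mem_ae_restrict (measurableSet_interlaces b)] with u hu
    exact mul_nonneg (dixonDensity_nonneg _ _ _) (Real.rpow_nonneg (Finset.prod_nonneg fun r _ =>
      (sub_pos.2 ((hx _).trans (hu.last_lt hb r))).le) _)
  · exact Measurable.aestronglyMeasurable (by fun_prop)

theorem integrableOn_dixonDensity {θ : ℝ} (hθ : 0 < θ) {m : ℕ} (hm : 0 < m)
    {b : Fin (m + 1) → ℝ} (hb : StrictAnti b) :
    IntegrableOn (dixonDensity θ b) {u | Interlaces u b} := by
  have hG := Real.Gamma_pos_of_pos hθ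
  have hGm := Real.Gamma_pos_of_pos (show 0 < m * θ by positivity)
  have hV : 0 < absVdm b := absVdm_pos hb.injective
  set x := b (Fin.last m) - 1 with hxdef
  have hbx : ∀ i, 1 ≤ b i - x := fun i => by
    linarith [hb.antitone (Fin.le_last i)]
  have hx : ∀ i, x < b i := fun i => by linarith [hbx i]
  have hintegrable : IntegrableOn (fun t : ℝ => t ^ (θ - 1) * ∏ i, (b i - x + t) ^ (-θ)) (Set.Ioi 0) := by
    refine Integrable.mono' (integrableOn_rpow_mul_one_add_rpow hθ
      (q := θ * (m + 1 : ℕ)) ?_) (Measurable.aestronglyMeasurable (by fun_prop)) ?_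
    · have : (0 : ℝ) < m := by exact_mod_cast hm
      push_cast
      nlinarith
    · filter_upwards [self_mem_ae_restrict measurableSet_Ioi] with t ht
      have ht0 : (0 : ℝ) < t := ht
      have hpos : ∀ i, 0 < b i - x + t := fun i => by linarith [hbx i]
      rw [Real.norm_of_nonneg (mul_nonneg (by positivity)
        (Finset.prod_nonneg fun i _ => Real.rpow_nonneg (hpos i).le _)), ← neg_mul,
        Real.rpow_mul_natCast (by positivity)]
      refine mul_le_mul_of_nonneg_left (prod_le_pow_of_forall_le
        (fun i => Real.rpow_nonneg (hpos i).le _) fun i => ?_) (by positivity)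
      exact Real.rpow_le_rpow_of_nonpos (by positivity) (by linarith [hbx i]) (by linarith)
  have hfin : ∫⁻ u in {u : Fin m → ℝ | Interlaces u b},
      ENNReal.ofReal (dixonDensity θ b u * (∏ r, (u r - x)) ^ (-θ)) ≠ ∞ := by
    intro htop
    have h := lintegral_dixonDensity hθ hm hb hx
    rw [htop, ENNReal.mul_top (by simp; positivity)] at h
    refine (ENNReal.mul_lt_top (by finiteness) ?_).ne h.symm
    exact (lintegral_mono fun t => Real.ofReal_le_enorm _).trans_lt hintegrable.2
  have hintegrable2 : IntegrableOn (fun u => dixonDensity θ b u * (∏ r, (u r - x)) ^ (-θ))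
      {u | Interlaces u b} := by
    refine (lintegral_ofReal_ne_top_iff_integrable
      (Measurable.aestronglyMeasurable (by fun_prop)) ?_).1 hfin
    filter_upwards [self_mem_ae_restrict (measurableSet_interlaces b)] with u hu
    exact mul_nonneg (dixonDensity_nonneg _ _ _) (Real.rpow_nonneg (Finset.prod_nonneg fun r _ =>
      (sub_pos.2 ((hx _).trans (hu.last_lt hb r))).le) _)
  refine Integrable.mono' (hintegrable2.const_mul (((b 0 - x) ^ m) ^ θ))
    (Measurable.aestronglyMeasurable (by fun_prop)) ?_
  filter_upwards [self_mem_ae_restrict (measurableSet_interlaces b)] with u hu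
  have hur : ∀ r, 0 < u r - x := fun r => sub_pos.2 ((hx _).trans (hu.last_lt hb r))
  have hU : 0 < ∏ r, (u r - x) := Finset.prod_pos fun r _ => hur r
  rw [Real.norm_of_nonneg (dixonDensity_nonneg _ _ _), mul_left_comm]
  refine le_mul_of_one_le_right (dixonDensity_nonneg _ _ _) ?_
  rw [Real.rpow_neg hU.le, ← div_eq_mul_inv, one_le_div (Real.rpow_pos_of_pos hU _)]
  refine Real.rpow_le_rpow hU.le ?_ hθ.le
  refine prod_le_pow_of_forall_le (fun r => (hur r).le) fun r => ?_
  linarith [hu.lt_of_le hb (Fin.zero_le r.castSucc)]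


@[fun_prop]
theorem Measurable.branchProd {X : Type*} [MeasurableSpace X] (θ : ℝ) {N : ℕ} {a : X → Fin N → ℝ}
    {z : X → ℂ} (ha : Measurable a) (hz : Measurable z) :
    Measurable fun x => branchProd θ (a x) (z x) := by
  unfold _root_.branchProd
  fun_prop

theorem integral_dixonDensity_mul_branchProd {θ : ℝ} (hθ : 0 < θ) {m : ℕ} (hm : 0 < m)
    {b : Fin (m + 1) → ℝ} (hb : StrictAnti b) {z : ℂ}
    (hz : (b (Fin.last m) : ℂ) - z ∈ Complex.slitPlane) :
    ((Real.Gamma (m * θ) * absVdm b ^ (1 - 2 * θ) : ℝ) : ℂ) *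
      ∫ u in {u : Fin m → ℝ | Interlaces u b}, (dixonDensity θ b u : ℂ) * branchProd θ u z =
    ((Real.Gamma θ ^ m : ℝ) : ℂ) *
      ∫ t in Set.Ioi (0 : ℝ), ((t ^ (θ - 1) : ℝ) : ℂ) * branchProd θ b (z - t) := by
  set β := b (Fin.last m) with hβ
  have hbβ : ∀ i, β ≤ b i := fun i => hb.antitone (Fin.le_last i)
  set U : Set ℂ := {z : ℂ | (β : ℂ) - z ∈ Complex.slitPlane} with hUdef
  have hU : IsOpen U := Complex.isOpen_slitPlane.preimage (by fun_prop)
  have hUc : IsPreconnected U := by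
    have himg : U = (fun w : ℂ => (β : ℂ) - w) '' Complex.slitPlane := by
      ext w
      refine ⟨fun hw => ⟨β - w, hw, by ring⟩, ?_⟩
      rintro ⟨v, hv, rfl⟩
      simpa [hUdef] using hv
    rw [himg]
    refine IsPreconnected.image ?_ _ (by fun_prop)
    exact (Complex.starConvex_one_slitPlane.isPathConnected (by simp)).isConnected.isPreconnected
  have hL : DifferentiableOn ℂ (fun z => ∫ u in {u : Fin m → ℝ | Interlaces u b},
      (dixonDensity θ b u : ℂ) * branchProd θ u z) U := by
    refine differentiableOn_integral_of_locally_dominated hU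
      (fun z _ => Measurable.aestronglyMeasurable (by fun_prop)) ?_ fun z₀ hz₀ => ?_
    · filter_upwards [self_mem_ae_restrict (measurableSet_interlaces b)] with u hu z hz
      exact ((differentiableAt_branchProd θ (fun r => (hu.last_lt hb r).le) hz).const_mul
        _).differentiableWithinAt
    · obtain ⟨δ, hδ, hfar⟩ := exists_ball_farFromRay hz₀
      refine ⟨δ, hδ, fun u => dixonDensity θ b u * (δ ^ (-θ)) ^ m,
        (integrableOn_dixonDensity hθ hm hb).mul_const _, ?_⟩
      filter_upwards [self_mem_ae_restrict (measurableSet_interlaces b)] with u hu z hz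
      rw [norm_mul, Complex.norm_real, Real.norm_of_nonneg (dixonDensity_nonneg _ _ _)]
      exact mul_le_mul_of_nonneg_left
        (norm_branchProd_le hθ hδ (fun r => (hu.last_lt hb r).le) (hfar z hz))
        (dixonDensity_nonneg _ _ _)
  have hR : DifferentiableOn ℂ (fun z => ∫ t in Set.Ioi (0 : ℝ),
      ((t ^ (θ - 1) : ℝ) : ℂ) * branchProd θ b (z - t)) U := by
    refine differentiableOn_integral_of_locally_dominated hU
      (fun z _ => Measurable.aestronglyMeasurable (by fun_prop)) ?_ fun z₀ hz₀ => ?_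
    · filter_upwards [self_mem_ae_restrict measurableSet_Ioi] with t ht z hz
      exact (((differentiableAt_branchProd θ hbβ
        (sub_sub_ofReal_mem_slitPlane (le_of_lt ht) hz)).comp z
        (differentiableAt_id.sub_const _)).const_mul _).differentiableWithinAt
    · obtain ⟨δ, hδ, hfar⟩ := exists_ball_farFromRay hz₀
      obtain ⟨A, hA, hbound⟩ := exists_norm_branchProd_sub_le hθ hδ hbβ
      have hq : θ < ((m + 1 : ℕ) : ℝ) * θ := by
        have : (0 : ℝ) < m := by exact_mod_cast hm
        push_cast
        nlinarith
      refine ⟨δ, hδ, fun t => (A * (1 + (‖z₀‖ + δ)) ^ (((m + 1 : ℕ) : ℝ) * θ)) *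
        (t ^ (θ - 1) * (1 + t) ^ (-(((m + 1 : ℕ) : ℝ) * θ))),
        (integrableOn_rpow_mul_one_add_rpow hθ hq).const_mul _, ?_⟩
      filter_upwards [self_mem_ae_restrict measurableSet_Ioi] with t ht z hz
      have ht0 : (0 : ℝ) < t := ht
      have hzn : ‖z‖ ≤ ‖z₀‖ + δ := by
        have h1 : ‖z - z₀‖ < δ := by simpa [dist_eq_norm] using hz
        calc ‖z‖ = ‖z₀ + (z - z₀)‖ := by ring_nf
          _ ≤ ‖z₀‖ + ‖z - z₀‖ := norm_add_le _ _
          _ ≤ _ := by linarith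
      rw [norm_mul, Complex.norm_real, Real.norm_of_nonneg (by positivity)]
      calc t ^ (θ - 1) * ‖branchProd θ b (z - t)‖
          ≤ t ^ (θ - 1) * (A * (1 + ‖z‖) ^ (((m + 1 : ℕ) : ℝ) * θ) *
            (1 + t) ^ (-(((m + 1 : ℕ) : ℝ) * θ))) := by
            gcongr
            exact hbound z (hfar z hz) t ht0.le
        _ ≤ t ^ (θ - 1) * (A * (1 + (‖z₀‖ + δ)) ^ (((m + 1 : ℕ) : ℝ) * θ) *
            (1 + t) ^ (-(((m + 1 : ℕ) : ℝ) * θ))) := by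
            gcongr
        _ = _ := by ring
  have hreal : ∀ x : ℝ, x < β →
      ((Real.Gamma (m * θ) * absVdm b ^ (1 - 2 * θ) : ℝ) : ℂ) *
        ∫ u in {u : Fin m → ℝ | Interlaces u b}, (dixonDensity θ b u : ℂ) * branchProd θ u x =
      ((Real.Gamma θ ^ m : ℝ) : ℂ) *
        ∫ t in Set.Ioi (0 : ℝ), ((t ^ (θ - 1) : ℝ) : ℂ) * branchProd θ b (x - t) := by
    intro x hx
    have h := integral_dixonDensity_real hθ hm hb fun i => hx.trans_le (hbβ i)
    have h1 : ∫ u in {u : Fin m → ℝ | Interlaces u b}, (dixonDensity θ b u : ℂ) * branchProd θ u x =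
        ((∫ u in {u : Fin m → ℝ | Interlaces u b},
          dixonDensity θ b u * (∏ r, (u r - x)) ^ (-θ) : ℝ) : ℂ) := by
      rw [← integral_complex_ofReal]
      refine setIntegral_congr_fun (measurableSet_interlaces b) fun u hu => ?_
      have hur : ∀ r, x < u r := fun r => hx.trans (Interlaces.last_lt hb hu r)
      rw [branchProd_ofReal θ hur, ← Real.finsetProd_rpow _ _ fun r _ => (sub_pos.2 (hur r)).le]
      push_cast
      rfl
    have h2 : ∫ t in Set.Ioi (0 : ℝ), ((t ^ (θ - 1) : ℝ) : ℂ) * branchProd θ b (x - t) =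
        ((∫ t in Set.Ioi (0 : ℝ), t ^ (θ - 1) * ∏ i, (b i - x + t) ^ (-θ) : ℝ) : ℂ) := by
      rw [← integral_complex_ofReal]
      refine setIntegral_congr_fun measurableSet_Ioi fun t ht => ?_
      have ht0 : (0 : ℝ) < t := ht
      rw [← Complex.ofReal_sub, branchProd_ofReal θ fun i => by linarith [hbβ i]]
      simp_rw [sub_sub_eq_add_sub, add_sub_right_comm]
      push_cast
      rfl
    rw [h1, h2]
    exact_mod_cast h
  have hx₀ : ((β - 1 : ℝ) : ℂ) ∈ U := by
    refine Or.inl ?_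
    simp
  refine AnalyticOnNhd.eqOn_of_preconnected_of_frequently_eq
    ((hL.const_mul _).analyticOnNhd hU) ((hR.const_mul _).analyticOnNhd hU) hUc hx₀
    (frequently_nhdsNE_of_eventually_ofReal ?_) hz
  filter_upwards [eventually_lt_nhds (sub_one_lt β)] with x hx
  exact hreal x hx

/-- The integral of `f` along the ray from `∞ + r i` to `M + r i`, the segment from `M + r i` to
`M - r i` and the ray from `M - r i` to `∞ - r i`. -/
def contourInt (M r : ℝ) (f : ℂ → ℂ) : ℂ :=
  -(∫ t in Set.Ici M, f (t + r * Complex.I)) -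
    Complex.I * (∫ s in (-r)..r, f (M + s * Complex.I)) +
    ∫ t in Set.Ici M, f (t - r * Complex.I)

/-- Membership in the contour of `contourInt M r`. -/
def OnContour (M r : ℝ) (z : ℂ) : Prop :=
  (M ≤ z.re ∧ |z.im| = r) ∨ (z.re = M ∧ |z.im| ≤ r)

theorem onContour_upper {M r t : ℝ} (hr : 0 < r) (ht : t ∈ Set.Ici M) :
    OnContour M r (t + r * Complex.I) :=
  Or.inl ⟨by simpa using ht, by simp [abs_of_pos hr]⟩

theorem onContour_lower {M r t : ℝ} (hr : 0 < r) (ht : t ∈ Set.Ici M) :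
    OnContour M r (t - r * Complex.I) :=
  Or.inl ⟨by simpa using ht, by simp [abs_of_pos hr]⟩

theorem onContour_side {M r s : ℝ} (hs : s ∈ Set.Ioc (-r) r) :
    OnContour M r (M + s * Complex.I) :=
  Or.inr ⟨by simp, by simpa using abs_le.2 ⟨hs.1.le, hs.2⟩⟩

theorem OnContour.farFromRay {M r β : ℝ} {z : ℂ} (hz : OnContour M r z) :
    FarFromRay β (min r (β - M)) z := by
  intro x hx
  rcases hz with ⟨-, h⟩ | ⟨h, -⟩
  · have := Complex.abs_im_le_norm ((x : ℂ) - z)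
    simp only [Complex.sub_im, Complex.ofReal_im, zero_sub, abs_neg, h] at this
    exact (min_le_left _ _).trans this
  · have := Complex.re_le_norm ((x : ℂ) - z)
    simp only [Complex.sub_re, Complex.ofReal_re, h] at this
    exact (min_le_right _ _).trans (by linarith)

theorem OnContour.sub_mem_slitPlane {M r β : ℝ} {z : ℂ} (hr : 0 < r) (hM : M < β)
    (hz : OnContour M r z) : (β : ℂ) - z ∈ Complex.slitPlane := by
  rw [Complex.mem_slitPlane_iff]
  simp only [Complex.sub_re, Complex.ofReal_re, Complex.sub_im, Complex.ofReal_im, zero_sub,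
    ne_eq, neg_eq_zero]
  rcases hz with ⟨-, h⟩ | ⟨h, -⟩
  · refine Or.inr fun h0 => ?_
    rw [h0, abs_zero] at h
    exact hr.ne h
  · exact Or.inl (by linarith)

theorem contourInt_congr {M r : ℝ} (hr : 0 < r) {f g : ℂ → ℂ}
    (h : ∀ z, OnContour M r z → f z = g z) : contourInt M r f = contourInt M r g := by
  unfold contourInt
  rw [setIntegral_congr_fun measurableSet_Ici fun t ht => h _ (onContour_upper hr ht),
    setIntegral_congr_fun measurableSet_Ici fun t ht => h _ (onContour_lower hr ht),
    intervalIntegral.integral_of_le (by linarith), intervalIntegral.integral_of_le (by linarith),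
    setIntegral_congr_fun measurableSet_Ioc fun s hs => h _ (onContour_side hs)]

theorem contourInt_const_mul (M r : ℝ) (c : ℂ) (f : ℂ → ℂ) :
    contourInt M r (fun z => c * f z) = c * contourInt M r f := by
  simp only [contourInt, integral_const_mul, intervalIntegral.integral_const_mul]
  ring

theorem integrableOn_Ici_norm_exp_mul_rpow {y : ℂ} (hy : 0 < y.re) {p : ℝ} (hp : 0 ≤ p)
    (M c : ℝ) :
    IntegrableOn (fun t : ℝ => ‖Complex.exp (-y * (t + c * Complex.I))‖ *
      (1 + ‖(t : ℂ) + c * Complex.I‖) ^ p) (Set.Ici M) := by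
  rw [integrableOn_Ici_iff_integrableOn_Ioi]
  refine integrable_of_isBigO_exp_neg (b := y.re / 2) (by positivity) ?_ ?_
  · refine Continuous.continuousOn ?_
    refine Continuous.mul (by fun_prop) (Continuous.rpow_const (by fun_prop) fun t => ?_)
    exact Or.inr hp
  · have hlo : (fun t : ℝ => (t + (1 + |c|)) ^ p) =O[atTop]
        fun t : ℝ => Real.exp (y.re / 2 * (t + (1 + |c|))) :=
      ((isLittleO_rpow_exp_pos_mul_atTop p (half_pos hy)).isBigO).comp_tendsto
        (tendsto_atTop_add_const_right _ _ tendsto_id)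
    have h1 : (fun t : ℝ => ‖Complex.exp (-y * (t + c * Complex.I))‖ *
        (1 + ‖(t : ℂ) + c * Complex.I‖) ^ p) =O[atTop]
        fun t : ℝ => Real.exp (-y.re * t) * (t + (1 + |c|)) ^ p := by
      refine Asymptotics.IsBigO.of_bound (Real.exp (y.im * c)) ?_
      filter_upwards [eventually_ge_atTop 0] with t ht
      have hn : ‖(t : ℂ) + c * Complex.I‖ ≤ t + |c| := by
        refine (norm_add_le _ _).trans (le_of_eq ?_)
        simp [abs_of_nonneg ht]
      rw [Real.norm_of_nonneg (by positivity), Real.norm_of_nonneg (by positivity),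
        Complex.norm_exp, ← mul_assoc, ← Real.exp_add]
      have he : (-y * (t + c * Complex.I)).re = y.im * c + -y.re * t := by
        simp
        ring
      rw [he]
      exact mul_le_mul_of_nonneg_left (Real.rpow_le_rpow (by positivity) (by linarith) hp)
        (Real.exp_nonneg _)
    refine h1.trans (((Asymptotics.isBigO_refl (fun t : ℝ => Real.exp (-y.re * t)) atTop).mul
      hlo).trans ?_)
    refine Asymptotics.IsBigO.of_bound (Real.exp (y.re / 2 * (1 + |c|))) (Eventually.of_forall
      fun t => ?_)
    rw [Real.norm_of_nonneg (by positivity), Real.norm_of_nonneg (by positivity), ← Real.exp_add,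
      ← Real.exp_add]
    exact le_of_eq (by ring_nf)

theorem integrableOn_Ici_norm_exp_mul_rpow_sub {y : ℂ} (hy : 0 < y.re) {p : ℝ} (hp : 0 ≤ p)
    (M c : ℝ) :
    IntegrableOn (fun t : ℝ => ‖Complex.exp (-y * (t - c * Complex.I))‖ *
      (1 + ‖(t : ℂ) - c * Complex.I‖) ^ p) (Set.Ici M) := by
  simpa [sub_eq_add_neg] using integrableOn_Ici_norm_exp_mul_rpow hy hp M (-c)

theorem integrableOn_Ioc_norm_exp_mul_rpow (y : ℂ) {p : ℝ} (hp : 0 ≤ p) (M r : ℝ) :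
    IntegrableOn (fun s : ℝ => ‖Complex.exp (-y * (M + s * Complex.I))‖ *
      (1 + ‖(M : ℂ) + s * Complex.I‖) ^ p) (Set.Ioc (-r) r) := by
  refine Continuous.integrableOn_Ioc ?_
  exact Continuous.mul (by fun_prop)
    (Continuous.rpow_const (by fun_prop) fun t => Or.inr hp)

theorem integral_path_swap {X : Type*} [MeasurableSpace X] {μ : Measure X} [SFinite μ] {S : Set X}
    (hS : MeasurableSet S) {T : Set ℝ} (hT : MeasurableSet T) {γ : ℝ → ℂ} (hγ : Measurable γ)
    {E : ℂ → ℂ} (hE : Measurable E) {w : ℂ → ℝ} {F : X → ℂ → ℂ}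
    (hF : Measurable fun q : X × ℂ => F q.1 q.2) {B : X → ℝ} (hB : IntegrableOn B S μ)
    (hw : IntegrableOn (fun t => ‖E (γ t)‖ * w (γ t)) T)
    (hbound : ∀ x ∈ S, ∀ t ∈ T, ‖F x (γ t)‖ ≤ B x * w (γ t)) :
    IntegrableOn (fun x => ∫ t in T, E (γ t) * F x (γ t)) S μ ∧
      ∫ x in S, (∫ t in T, E (γ t) * F x (γ t)) ∂μ =
        ∫ t in T, E (γ t) * ∫ x in S, F x (γ t) ∂μ := by
  have hintegrable : Integrable (fun q : X × ℝ => E (γ q.2) * F q.1 (γ q.2))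
      ((μ.restrict S).prod (volume.restrict T)) := by
    refine Integrable.mono' (Integrable.mul_prod hB hw) ?_ ?_
    · refine Measurable.aestronglyMeasurable ?_
      exact (hE.comp (hγ.comp measurable_snd)).mul
        (hF.comp (measurable_fst.prodMk (hγ.comp measurable_snd)))
    · rw [Measure.prod_restrict]
      filter_upwards [self_mem_ae_restrict (hS.prod hT)] with q hq
      rw [norm_mul]
      calc ‖E (γ q.2)‖ * ‖F q.1 (γ q.2)‖ ≤ ‖E (γ q.2)‖ * (B q.1 * w (γ q.2)) := by
            gcongr
            exact hbound _ hq.1 _ hq.2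
        _ = _ := by ring
  refine ⟨hintegrable.integral_prod_left, ?_⟩
  rw [integral_integral_swap hintegrable]
  simp only [integral_const_mul]

theorem integral_contourInt_swap {X : Type*} [MeasurableSpace X] {μ : Measure X} [SFinite μ]
    {S : Set X} (hS : MeasurableSet S) {M r : ℝ} (hr : 0 < r) {y : ℂ} (hy : 0 < y.re)
    {p : ℝ} (hp : 0 ≤ p) {F : X → ℂ → ℂ} (hF : Measurable fun q : X × ℂ => F q.1 q.2)
    {B : X → ℝ} (hB : IntegrableOn B S μ)
    (hbound : ∀ x ∈ S, ∀ z, OnContour M r z → ‖F x z‖ ≤ B x * (1 + ‖z‖) ^ p) :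
    IntegrableOn (fun x => contourInt M r fun z => Complex.exp (-y * z) * F x z) S μ ∧
      ∫ x in S, (contourInt M r fun z => Complex.exp (-y * z) * F x z) ∂μ =
        contourInt M r fun z => Complex.exp (-y * z) * ∫ x in S, F x z ∂μ := by
  have hE : Measurable fun z : ℂ => Complex.exp (-y * z) := by fun_prop
  obtain ⟨i1, e1⟩ := integral_path_swap (w := fun z => (1 + ‖z‖) ^ p) hS measurableSet_Ici
    (γ := fun t : ℝ => (t : ℂ) + r * Complex.I) (by fun_prop) hE hF hB
    (integrableOn_Ici_norm_exp_mul_rpow hy hp M r)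
    fun x hx t ht => hbound x hx _ (onContour_upper hr ht)
  obtain ⟨i2, e2⟩ := integral_path_swap (w := fun z => (1 + ‖z‖) ^ p) hS measurableSet_Ioc
    (γ := fun s : ℝ => (M : ℂ) + s * Complex.I) (by fun_prop) hE hF hB
    (integrableOn_Ioc_norm_exp_mul_rpow y hp M r)
    fun x hx t ht => hbound x hx _ (onContour_side ht)
  obtain ⟨i3, e3⟩ := integral_path_swap (w := fun z => (1 + ‖z‖) ^ p) hS measurableSet_Ici
    (γ := fun t : ℝ => (t : ℂ) - r * Complex.I) (by fun_prop) hE hF hB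
    (integrableOn_Ici_norm_exp_mul_rpow_sub hy hp M r)
    fun x hx t ht => hbound x hx _ (onContour_lower hr ht)
  simp only [contourInt, intervalIntegral.integral_of_le (show -r ≤ r by linarith)]
  refine ⟨(i1.neg.sub (i2.const_mul _)).add i3, ?_⟩
  refine (integral_add (i1.neg.sub (i2.const_mul Complex.I)) i3).trans ?_
  refine (congrArg (· + _) (integral_sub i1.neg (i2.const_mul Complex.I))).trans ?_
  simp only [Pi.neg_apply, integral_neg, integral_const_mul, e1, e2, e3]

theorem setIntegral_Ici_sub_right (g : ℝ → ℂ) (M t : ℝ) :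
    ∫ x in Set.Ici M, g (x - t) = ∫ x in Set.Ici (M - t), g x := by
  have h := (measurePreserving_sub_right volume t).setIntegral_preimage_emb
    (MeasurableEquiv.subRight t).measurableEmbedding g (Set.Ici (M - t))
  rw [← h]
  congr 2
  ext x
  simp

theorem contourInt_comp_sub_ofReal (M r t : ℝ) (f : ℂ → ℂ) :
    contourInt M r (fun z => f (z - t)) = contourInt (M - t) r f := by
  unfold contourInt
  rw [← setIntegral_Ici_sub_right (fun x => f (x + r * Complex.I)),
    ← setIntegral_Ici_sub_right (fun x => f (x - r * Complex.I))]
  congr 3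
  · congr 1
    ext x
    push_cast
    ring_nf
  · congr 1
    ext s
    push_cast
    ring_nf
  · ext x
    push_cast
    ring_nf

theorem contourInt_eq_of_le {M' M r : ℝ} (hM : M' ≤ M) {f : ℂ → ℂ}
    (hd : DifferentiableOn ℂ f (Set.uIcc M' M ×ℂ Set.uIcc (-r) r))
    (h1 : IntegrableOn (fun t : ℝ => f (t + r * Complex.I)) (Set.Ici M'))
    (h2 : IntegrableOn (fun t : ℝ => f (t - r * Complex.I)) (Set.Ici M')) :
    contourInt M' r f = contourInt M r f := by
  have hrect := Complex.integral_boundary_rect_eq_zero_of_differentiableOn f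
    (M' + (-r : ℝ) * Complex.I) (M + r * Complex.I) (by simpa using hd)
  simp only [Complex.add_re, Complex.ofReal_re, Complex.mul_re, Complex.I_re, mul_zero,
    Complex.ofReal_im, Complex.I_im, mul_one, sub_self, add_zero, Complex.add_im, Complex.mul_im,
    zero_add, smul_eq_mul] at hrect
  have e1 : (∫ t in Set.Ici M', f (t + r * Complex.I)) =
      (∫ t in M'..M, f (t + r * Complex.I)) + ∫ t in Set.Ici M, f (t + r * Complex.I) := by
    rw [integral_Ici_eq_integral_Ioi, integral_Ici_eq_integral_Ioi]
    exact (intervalIntegral.integral_interval_add_Ioi (h1.mono_set Set.Ioi_subset_Ici_self)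
      (h1.mono_set (Set.Ioi_subset_Ici hM))).symm
  have e2 : (∫ t in Set.Ici M', f (t - r * Complex.I)) =
      (∫ t in M'..M, f (t - r * Complex.I)) + ∫ t in Set.Ici M, f (t - r * Complex.I) := by
    rw [integral_Ici_eq_integral_Ioi, integral_Ici_eq_integral_Ioi]
    exact (intervalIntegral.integral_interval_add_Ioi (h2.mono_set Set.Ioi_subset_Ici_self)
      (h2.mono_set (Set.Ioi_subset_Ici hM))).symm
  simp only [Complex.ofReal_neg, neg_mul, ← sub_eq_add_neg] at hrect
  unfold contourInt
  rw [e1, e2]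
  linear_combination hrect

theorem integrableOn_Ici_exp_mul_branchProd {θ : ℝ} (hθ : 0 < θ) {N : ℕ} {a : Fin N → ℝ}
    {β M r : ℝ} (ha : ∀ i, β ≤ a i) (hM : M < β) (hr : 0 < r) {y : ℂ} (hy : 0 < y.re) :
    IntegrableOn (fun t : ℝ => Complex.exp (-y * (t + r * Complex.I)) *
        branchProd θ a (t + r * Complex.I)) (Set.Ici M) ∧
      IntegrableOn (fun t : ℝ => Complex.exp (-y * (t - r * Complex.I)) *
        branchProd θ a (t - r * Complex.I)) (Set.Ici M) := by
  have hδ : 0 < min r (β - M) := lt_min hr (by linarith)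
  constructor
  · refine Integrable.mono' ((integrableOn_Ici_norm_exp_mul_rpow hy le_rfl M r).mul_const
      ((min r (β - M) ^ (-θ)) ^ N)) (Measurable.aestronglyMeasurable (by fun_prop)) ?_
    filter_upwards [self_mem_ae_restrict measurableSet_Ici] with t ht
    rw [norm_mul, Real.rpow_zero, mul_one]
    gcongr
    exact norm_branchProd_le hθ hδ ha (onContour_upper hr ht).farFromRay
  · refine Integrable.mono' ((integrableOn_Ici_norm_exp_mul_rpow_sub hy le_rfl M r).mul_const
      ((min r (β - M) ^ (-θ)) ^ N)) (Measurable.aestronglyMeasurable (by fun_prop)) ?_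
    filter_upwards [self_mem_ae_restrict measurableSet_Ici] with t ht
    rw [norm_mul, Real.rpow_zero, mul_one]
    gcongr
    exact norm_branchProd_le hθ hδ ha (onContour_lower hr ht).farFromRay

theorem contourInt_exp_mul_branchProd_sub {θ : ℝ} (hθ : 0 < θ) {N : ℕ} {a : Fin N → ℝ}
    {β M r : ℝ} (ha : ∀ i, β ≤ a i) (hM : M < β) (hr : 0 < r) {y : ℂ} (hy : 0 < y.re)
    {t : ℝ} (ht : 0 ≤ t) :
    (contourInt M r fun z => Complex.exp (-y * z) * branchProd θ a (z - t)) =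
      Complex.exp (-y * t) * contourInt M r fun z => Complex.exp (-y * z) * branchProd θ a z := by
  have hfun : (fun z : ℂ => Complex.exp (-y * z) * branchProd θ a (z - t)) = fun z =>
      Complex.exp (-y * t) * (Complex.exp (-y * (z - t)) * branchProd θ a (z - t)) := by
    ext z
    rw [← mul_assoc, ← Complex.exp_add]
    ring_nf
  obtain ⟨h1, h2⟩ := integrableOn_Ici_exp_mul_branchProd hθ ha (show M - t < β by linarith) hr hy
  rw [hfun, contourInt_const_mul,
    contourInt_comp_sub_ofReal M r t fun z => Complex.exp (-y * z) * branchProd θ a z,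
    contourInt_eq_of_le (show M - t ≤ M by linarith) _ h1 h2]
  intro z hz
  refine (DifferentiableAt.mul (by fun_prop)
    (differentiableAt_branchProd θ ha ?_)).differentiableWithinAt
  rw [Complex.mem_reProdIm, Set.uIcc_of_le (by linarith), Set.mem_Icc] at hz
  refine Complex.mem_slitPlane_iff.2 (Or.inl ?_)
  simp only [Complex.sub_re, Complex.ofReal_re]
  linarith [hz.1.2]

theorem contourInt_exp_mul_integral_branchProd {θ : ℝ} (hθ : 0 < θ) {N : ℕ} {a : Fin N → ℝ}
    {β M r : ℝ} (ha : ∀ i, β ≤ a i) (hM : M < β) (hr : 0 < r) {y : ℂ} (hy : 0 < y.re)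
    {s : ℝ} (hs : 0 < s) (hsN : s < N * θ) :
    (contourInt M r fun z => Complex.exp (-y * z) *
        ∫ t in Set.Ioi (0 : ℝ), ((t ^ (s - 1) : ℝ) : ℂ) * branchProd θ a (z - t)) =
      Real.Gamma s * Complex.exp (-(s : ℂ) * Complex.log y) *
        contourInt M r fun z => Complex.exp (-y * z) * branchProd θ a z := by
  have hδ : 0 < min r (β - M) := lt_min hr (by linarith)
  obtain ⟨A, hA, hbound⟩ := exists_norm_branchProd_sub_le hθ hδ ha
  have hswap := integral_contourInt_swap (μ := volume) (S := Set.Ioi (0 : ℝ)) measurableSet_Ioi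
    (M := M) hr hy (p := N * θ) (by positivity)
    (F := fun t z => ((t ^ (s - 1) : ℝ) : ℂ) * branchProd θ a (z - t)) (by fun_prop)
    ((integrableOn_rpow_mul_one_add_rpow hs hsN).const_mul A) fun t ht z hz => by
      have ht0 : (0 : ℝ) < t := ht
      rw [norm_mul, Complex.norm_real, Real.norm_of_nonneg (by positivity)]
      calc t ^ (s - 1) * ‖branchProd θ a (z - t)‖
          ≤ t ^ (s - 1) * (A * (1 + ‖z‖) ^ (N * θ) * (1 + t) ^ (-(N * θ))) := by
            gcongr
            exact hbound z hz.farFromRay t ht0.le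
        _ = _ := by ring
  rw [← hswap.2, ← integral_rpow_mul_cexp_neg_mul_Ioi hs hy, ← integral_mul_const]
  refine setIntegral_congr_fun measurableSet_Ioi fun t ht => ?_
  simp only [mul_left_comm (Complex.exp _)]
  rw [contourInt_const_mul, contourInt_exp_mul_branchProd_sub hθ ha hM hr hy (le_of_lt ht)]
  ring

theorem integral_inv_line {p q : ℂ} {t₀ t₁ : ℝ}
    (h : ∀ t ∈ Set.uIcc t₀ t₁, p + t * q ∈ Complex.slitPlane) :
    IntervalIntegrable (fun t : ℝ => (p + t * q)⁻¹) volume t₀ t₁ ∧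
      q * ∫ t in t₀..t₁, (p + t * q)⁻¹ =
        Complex.log (p + t₁ * q) - Complex.log (p + t₀ * q) := by
  have hintegrable : IntervalIntegrable (fun t : ℝ => (p + t * q)⁻¹) volume t₀ t₁ := by
    refine ContinuousOn.intervalIntegrable (ContinuousOn.inv₀ (by fun_prop) fun t ht => ?_)
    exact Complex.slitPlane_ne_zero (h t ht)
  refine ⟨hintegrable, ?_⟩
  rw [← intervalIntegral.integral_const_mul]
  refine intervalIntegral.integral_eq_sub_of_hasDerivAt
    (f := fun t : ℝ => Complex.log (p + t * q)) (fun t ht => ?_) (hintegrable.const_mul q)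
  have h1 : HasDerivAt (fun t : ℝ => p + t * q) q t := by
    simpa using ((Complex.ofRealCLM.hasDerivAt (x := t)).mul_const q).const_add p
  simpa [div_eq_mul_inv] using h1.clog_real (h t ht)

theorem tendsto_log_sub_log_neg_atTop (a : ℝ) {r : ℝ} (hr : 0 < r) :
    Tendsto (fun R : ℝ => Complex.log (a - (R + r * Complex.I)) -
      Complex.log (a - (R - r * Complex.I))) atTop (𝓝 (-(2 * Real.pi * Complex.I))) := by
  have harg : Tendsto (fun R : ℝ => Complex.arg (-1 + ((r / (R - a) : ℝ) : ℂ) * Complex.I)) atTop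
      (𝓝 Real.pi) := by
    have h0 : Tendsto (fun R : ℝ => r / (R - a)) atTop (𝓝 0) :=
      tendsto_const_nhds.div_atTop (tendsto_atTop_add_const_right _ _ tendsto_id)
    have h1 : Tendsto (fun R : ℝ => -1 + ((r / (R - a) : ℝ) : ℂ) * Complex.I) atTop (𝓝 (-1)) := by
      have := ((Complex.continuous_ofReal.tendsto 0).comp h0).mul_const Complex.I
      simpa using this.const_add (-1)
    have h2 := (Complex.continuousWithinAt_arg_of_re_neg_of_im_zero (z := -1) (by simp)
      (by simp)).tendsto
    rw [Complex.arg_neg_one] at h2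
    refine h2.comp (tendsto_nhdsWithin_iff.2 ⟨h1, ?_⟩)
    filter_upwards [eventually_gt_atTop a] with R hR
    have : 0 < r / (R - a) := div_pos hr (by linarith)
    simp only [Complex.add_im, Complex.neg_im, Complex.one_im, Complex.mul_im,
      Complex.ofReal_re, Complex.I_im, Complex.ofReal_im, Complex.I_re]
    linarith
  have hlim : Tendsto (fun R : ℝ => -(2 *
      ((Complex.arg (-1 + ((r / (R - a) : ℝ) : ℂ) * Complex.I) : ℝ) : ℂ) * Complex.I)) atTop
      (𝓝 (-(2 * Real.pi * Complex.I))) :=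
    ((((Complex.continuous_ofReal.tendsto _).comp harg).const_mul 2).mul_const _).neg
  refine hlim.congr' ?_
  filter_upwards [eventually_gt_atTop a] with R hR
  have hRa : 0 < R - a := by linarith
  set w : ℂ := a - (R - r * Complex.I) with hw
  have hwim : w.im = r := by simp [hw]
  have hconj : (a : ℂ) - (R + r * Complex.I) = (starRingEnd ℂ) w := by
    simp only [hw, map_sub, map_mul, Complex.conj_ofReal, Complex.conj_I]
    ring
  have hne : w.arg ≠ Real.pi := by
    rw [Ne, Complex.arg_eq_pi_iff, hwim]
    exact fun h => hr.ne' h.2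
  have hscale : w = ((R - a : ℝ) : ℂ) * (-1 + ((r / (R - a) : ℝ) : ℂ) * Complex.I) := by
    have : ((R : ℂ) - a) ≠ 0 := by exact_mod_cast hRa.ne'
    rw [hw]
    push_cast
    field_simp
    ring
  have harg' : w.arg = Complex.arg (-1 + ((r / (R - a) : ℝ) : ℂ) * Complex.I) := by
    rw [hscale, Complex.arg_real_mul _ hRa]
  rw [hconj, Complex.log_conj _ hne, ← neg_sub (Complex.log w), Complex.sub_conj, Complex.log_im, harg']
  push_cast
  ring

/-- The part of `contourInt M r f` over points with real part at most `R`. -/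
def truncContourInt (M R r : ℝ) (f : ℂ → ℂ) : ℂ :=
  -(∫ t in M..R, f (t + r * Complex.I)) -
    Complex.I * (∫ s in (-r)..r, f (M + s * Complex.I)) +
    ∫ t in M..R, f (t - r * Complex.I)

theorem tendsto_truncContourInt {M r : ℝ} {f : ℂ → ℂ}
    (h1 : IntegrableOn (fun t : ℝ => f (t + r * Complex.I)) (Set.Ici M))
    (h2 : IntegrableOn (fun t : ℝ => f (t - r * Complex.I)) (Set.Ici M)) :
    Tendsto (fun R => truncContourInt M R r f) atTop (𝓝 (contourInt M r f)) := by
  unfold truncContourInt contourInt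
  rw [integral_Ici_eq_integral_Ioi, integral_Ici_eq_integral_Ioi]
  exact ((intervalIntegral_tendsto_integral_Ioi M
    (h1.mono_set Set.Ioi_subset_Ici_self) tendsto_id).neg.sub tendsto_const_nhds).add
    (intervalIntegral_tendsto_integral_Ioi M
      (h2.mono_set Set.Ioi_subset_Ici_self) tendsto_id)

theorem truncContourInt_of_differentiable {f : ℂ → ℂ} (hf : Differentiable ℂ f) (M R r : ℝ) :
    truncContourInt M R r f = -(Complex.I * ∫ s in (-r)..r, f (R + s * Complex.I)) := by
  have hrect := Complex.integral_boundary_rect_eq_zero_of_differentiableOn f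
    (M + (-r : ℝ) * Complex.I) (R + r * Complex.I) hf.differentiableOn
  simp only [Complex.add_re, Complex.ofReal_re, Complex.mul_re, Complex.I_re, mul_zero,
    Complex.ofReal_im, Complex.I_im, mul_one, sub_self, add_zero, Complex.add_im, Complex.mul_im,
    zero_add, smul_eq_mul] at hrect
  simp only [Complex.ofReal_neg, neg_mul, ← sub_eq_add_neg] at hrect
  unfold truncContourInt
  linear_combination hrect

theorem truncContourInt_add_const_mul_inv {h : ℂ → ℂ} (hh : Continuous h) (c : ℂ) {a M r : ℝ}
    (hM : M < a) (hr : 0 < r) (R : ℝ) :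
    truncContourInt M R r (fun z => h z + c * ((a : ℂ) - z)⁻¹) =
      truncContourInt M R r h + c * (Complex.log (a - (R + r * Complex.I)) -
        Complex.log (a - (R - r * Complex.I))) := by
  obtain ⟨i1, e1⟩ := integral_inv_line (p := a - r * Complex.I) (q := -1) (t₀ := M) (t₁ := R)
    fun t _ => Complex.mem_slitPlane_iff.2 (Or.inr (by simpa using hr.ne'))
  obtain ⟨i2, e2⟩ := integral_inv_line (p := a - M) (q := -Complex.I) (t₀ := -r) (t₁ := r)
    fun t _ => Complex.mem_slitPlane_iff.2 (Or.inl (by simpa using hM))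
  obtain ⟨i3, e3⟩ := integral_inv_line (p := a + r * Complex.I) (q := -1) (t₀ := M) (t₁ := R)
    fun t _ => Complex.mem_slitPlane_iff.2 (Or.inr (by simpa using hr.ne'))
  have f1 : ∀ t : ℝ, (a : ℂ) - r * Complex.I + t * -1 = a - (t + r * Complex.I) := fun t => by ring
  have f2 : ∀ t : ℝ, (a : ℂ) - M + t * -Complex.I = a - (M + t * Complex.I) := fun t => by ring
  have f3 : ∀ t : ℝ, (a : ℂ) + r * Complex.I + t * -1 = a - (t - r * Complex.I) := fun t => by ring
  simp only [f1] at i1 e1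
  simp only [f2] at i2 e2
  simp only [f3] at i3 e3
  unfold truncContourInt
  rw [intervalIntegral.integral_add
      (Continuous.intervalIntegrable (by fun_prop) _ _) (i1.const_mul c),
    intervalIntegral.integral_add
      (Continuous.intervalIntegrable (by fun_prop) _ _) (i2.const_mul c),
    intervalIntegral.integral_add
      (Continuous.intervalIntegrable (by fun_prop) _ _) (i3.const_mul c)]
  simp only [intervalIntegral.integral_const_mul]
  push_cast at e2
  rw [neg_mul (r : ℂ), ← sub_eq_add_neg] at e2
  linear_combination c * e1 + c * e2 - c * e3

theorem contourInt_exp_mul_inv {a M r : ℝ} (hM : M < a) (hr : 0 < r) {y : ℂ} (hy : 0 < y.re) :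
    (contourInt M r fun z => Complex.exp (-y * z) * ((a : ℂ) - z)⁻¹) =
      -(2 * Real.pi * Complex.I) * Complex.exp (-y * a) := by
  have hinv : ∀ z, OnContour M r z → branchProd 1 (fun _ : Fin 1 => a) z = ((a : ℂ) - z)⁻¹ := by
    intro z hz
    have hne := Complex.slitPlane_ne_zero (hz.sub_mem_slitPlane hr hM)
    simp [branchProd, Complex.exp_neg, Complex.exp_log hne]
  obtain ⟨h1, h2⟩ := integrableOn_Ici_exp_mul_branchProd one_pos (a := fun _ : Fin 1 => a)
    (fun _ => le_rfl) hM hr hy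
  have h1' : IntegrableOn (fun t : ℝ => Complex.exp (-y * (t + r * Complex.I)) *
      ((a : ℂ) - (t + r * Complex.I))⁻¹) (Set.Ici M) :=
    h1.congr_fun (fun t ht => by simp only [hinv _ (onContour_upper hr ht)]) measurableSet_Ici
  have h2' : IntegrableOn (fun t : ℝ => Complex.exp (-y * (t - r * Complex.I)) *
      ((a : ℂ) - (t - r * Complex.I))⁻¹) (Set.Ici M) :=
    h2.congr_fun (fun t ht => by simp only [hinv _ (onContour_lower hr ht)]) measurableSet_Ici
  set E : ℂ → ℂ := fun z => Complex.exp (-y * z) with hE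
  set h : ℂ → ℂ := fun z => -dslope E a z with hh
  have hhne : ∀ z : ℂ, z ≠ a → h z = (E z - E a) * ((a : ℂ) - z)⁻¹ := by
    intro z hz
    rw [hh]
    simp only
    rw [dslope_of_ne _ hz, slope_def_field, div_eq_mul_inv, ← neg_sub z (a : ℂ), inv_neg]
    ring
  have hhd : Differentiable ℂ h := by
    have : DifferentiableOn ℂ (dslope E a) Set.univ :=
      (Complex.differentiableOn_dslope univ_mem).2
        (Differentiable.differentiableOn (by fun_prop))
    exact (differentiableOn_univ.1 this).neg
  have hsum : ∀ z, OnContour M r z → Complex.exp (-y * z) * ((a : ℂ) - z)⁻¹ =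
      h z + Complex.exp (-y * a) * ((a : ℂ) - z)⁻¹ := by
    intro z hz
    have hne := Complex.slitPlane_ne_zero (hz.sub_mem_slitPlane hr hM)
    rw [hhne z fun h => hne (by rw [h, sub_self]), hE]
    ring
  have hlim := tendsto_truncContourInt
    (f := fun z => h z + Complex.exp (-y * a) * ((a : ℂ) - z)⁻¹)
    (h1'.congr_fun (fun t ht => hsum _ (onContour_upper hr ht)) measurableSet_Ici)
    (h2'.congr_fun (fun t ht => hsum _ (onContour_lower hr ht)) measurableSet_Ici)
  simp only [truncContourInt_add_const_mul_inv hhd.continuous _ hM hr,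
    truncContourInt_of_differentiable hhd] at hlim
  have hzero : Tendsto (fun R : ℝ => ∫ s in (-r)..r, h (R + s * Complex.I)) atTop (𝓝 0) := by
    set C := Real.exp (|y.im| * r) + ‖E a‖ with hC
    have hb : Tendsto (fun R : ℝ => C / (R - a) * |r - -r|) atTop (𝓝 0) := by
      simpa only [zero_mul, ← sub_eq_add_neg, id] using ((tendsto_const_nhds (x := C)).div_atTop
        (tendsto_atTop_add_const_right atTop (-a) tendsto_id)).mul_const |r - -r|
    refine squeeze_zero_norm' ?_ hb
    filter_upwards [eventually_gt_atTop a, eventually_ge_atTop 0] with R hRa hR0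
    refine intervalIntegral.norm_integral_le_of_norm_le_const fun s hs => ?_
    rw [Set.uIoc_of_le (by linarith)] at hs
    have hre : R - a ≤ ‖(a : ℂ) - (R + s * Complex.I)‖ := by
      have := (neg_le_abs _).trans (Complex.abs_re_le_norm ((a : ℂ) - (R + s * Complex.I)))
      simpa using this
    have hne : (R : ℂ) + s * Complex.I ≠ a := by
      intro h
      rw [h, sub_self, norm_zero] at hre
      linarith
    rw [hhne _ hne, norm_mul, norm_inv, ← div_eq_mul_inv]
    have hEn : ‖E (R + s * Complex.I)‖ ≤ Real.exp (|y.im| * r) := by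
      rw [hE, Complex.norm_exp]
      refine Real.exp_le_exp.2 ?_
      have h3 : (-y * (R + s * Complex.I)).re = -(y.re * R) + y.im * s := by
        simp
        ring
      have h4 : y.im * s ≤ |y.im| * r :=
        (le_abs_self _).trans (by rw [abs_mul]; gcongr; exact abs_le.2 ⟨hs.1.le, hs.2⟩)
      rw [h3]
      nlinarith [mul_nonneg hy.le hR0]
    exact div_le_div₀ (by positivity) ((norm_sub_le _ _).trans (by rw [hC]; gcongr))
      (by linarith) hre
  rw [contourInt_congr hr hsum]
  refine tendsto_nhds_unique hlim ?_
  have := ((hzero.const_mul Complex.I).neg).add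
    ((tendsto_log_sub_log_neg_atTop a hr).const_mul (Complex.exp (-y * a)))
  convert this using 2
  ring

theorem integrableOn_rpow_mul_branchProd_sub {θ : ℝ} (hθ : 0 < θ) {N : ℕ} {a : Fin N → ℝ}
    {β : ℝ} (ha : ∀ i, β ≤ a i) {z : ℂ} (hz : (β : ℂ) - z ∈ Complex.slitPlane) {s : ℝ}
    (hs : 0 < s) (hsN : s < N * θ) :
    IntegrableOn (fun t : ℝ => ((t ^ (s - 1) : ℝ) : ℂ) * branchProd θ a (z - t))
      (Set.Ioi 0) := by
  obtain ⟨δ, hδ, hfar⟩ := exists_ball_farFromRay hz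
  obtain ⟨A, hA, hbound⟩ := exists_norm_branchProd_sub_le hθ hδ ha
  refine Integrable.mono' ((integrableOn_rpow_mul_one_add_rpow hs hsN).const_mul
    (A * (1 + ‖z‖) ^ (N * θ))) (Measurable.aestronglyMeasurable (by fun_prop)) ?_
  filter_upwards [self_mem_ae_restrict measurableSet_Ioi] with t ht
  have ht0 : (0 : ℝ) < t := ht
  rw [norm_mul, Complex.norm_real, Real.norm_of_nonneg (by positivity)]
  calc t ^ (s - 1) * ‖branchProd θ a (z - t)‖
      ≤ t ^ (s - 1) * (A * (1 + ‖z‖) ^ (N * θ) * (1 + t) ^ (-(N * θ))) := by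
        gcongr
        exact hbound z (hfar z (Metric.mem_ball_self hδ)) t ht0.le
    _ = _ := by ring

theorem hasDerivAt_exp_neg_mul_log_add (θ : ℝ) {w : ℂ} {t : ℝ} (h : w + t ∈ Complex.slitPlane) :
    HasDerivAt (fun t : ℝ => Complex.exp (-(θ : ℂ) * Complex.log (w + t)))
      (-(θ : ℂ) * Complex.exp (-((θ + 1 : ℝ) : ℂ) * Complex.log (w + t))) t := by
  have h1 : HasDerivAt (fun t : ℝ => w + (t : ℂ)) 1 t := by
    simpa using (Complex.ofRealCLM.hasDerivAt (x := t)).const_add w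
  have h2 := ((h1.clog_real h).const_mul (-(θ : ℂ))).cexp
  convert h2 using 1
  have h3 : Complex.exp (-((θ + 1 : ℝ) : ℂ) * Complex.log (w + t)) =
      Complex.exp (-(θ : ℂ) * Complex.log (w + t)) * (w + t)⁻¹ := by
    rw [← Complex.exp_log (Complex.slitPlane_ne_zero h), ← Complex.exp_neg, ← Complex.exp_add,
      Complex.exp_log (Complex.slitPlane_ne_zero h)]
    push_cast
    ring_nf
  rw [h3]
  ring

theorem tendsto_exp_neg_mul_log_add_atTop {θ : ℝ} (hθ : 0 < θ) (w : ℂ) :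
    Tendsto (fun t : ℝ => Complex.exp (-(θ : ℂ) * Complex.log (w + t))) atTop (𝓝 0) := by
  have hn : Tendsto (fun t : ℝ => ‖w + (t : ℂ)‖) atTop atTop := by
    refine tendsto_atTop_mono (fun t => ?_) (tendsto_atTop_add_const_left atTop w.re tendsto_id)
    simpa using Complex.re_le_norm (w + (t : ℂ))
  rw [tendsto_zero_iff_norm_tendsto_zero]
  refine ((tendsto_rpow_neg_atTop hθ).comp hn).congr' ?_
  filter_upwards [hn.eventually_gt_atTop 0] with t ht
  exact (norm_exp_neg_mul_log θ (norm_pos_iff.1 ht)).symm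

theorem tendsto_rpow_mul_exp_neg_mul_log_add_atTop (θ : ℝ) (w : ℂ) :
    Tendsto (fun t : ℝ => ((t ^ θ : ℝ) : ℂ) * Complex.exp (-(θ : ℂ) * Complex.log (w + t))) atTop
      (𝓝 1) := by
  have h0 : Tendsto (fun t : ℝ => 1 + w / (t : ℂ)) atTop (𝓝 1) := by
    have h : Tendsto (fun t : ℝ => w * ((t⁻¹ : ℝ) : ℂ)) atTop (𝓝 (w * ((0 : ℝ) : ℂ))) :=
      ((Complex.continuous_ofReal.tendsto 0).comp tendsto_inv_atTop_zero).const_mul w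
    simpa [div_eq_mul_inv] using h.const_add 1
  have h1 : Tendsto (fun t : ℝ => Complex.exp (-(θ : ℂ) * Complex.log (1 + w / (t : ℂ)))) atTop
      (𝓝 1) := by
    have := (((continuousAt_clog Complex.one_mem_slitPlane).tendsto.comp h0).const_mul
      (-(θ : ℂ))).cexp
    simpa using this
  refine h1.congr' ?_
  filter_upwards [eventually_gt_atTop 0, h0.eventually_ne one_ne_zero] with t ht hne
  have htne : (t : ℂ) ≠ 0 := by exact_mod_cast ht.ne'
  have hw : w + t = (t : ℂ) * (1 + w / t) := by
    field_simp
    ring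
  rw [hw, Complex.log_ofReal_mul ht hne, Real.rpow_def_of_pos ht, Complex.ofReal_exp,
    ← Complex.exp_add]
  push_cast
  ring_nf

theorem branchProd_const_fin_one (θ a : ℝ) (z : ℂ) :
    branchProd θ (fun _ : Fin 1 => a) z =
      Complex.exp (-(θ : ℂ) * Complex.log ((a : ℂ) - z)) := by
  simp [branchProd]

theorem integral_branchProd_add_one_sub {θ : ℝ} (hθ : 0 < θ) {a : ℝ} {z : ℂ}
    (hz : (a : ℂ) - z ∈ Complex.slitPlane) :
    ∫ t in Set.Ioi (0 : ℝ), ((t ^ ((1 : ℝ) - 1) : ℝ) : ℂ) *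
        branchProd (θ + 1) (fun _ : Fin 1 => a) (z - t) =
      (θ : ℂ)⁻¹ * branchProd θ (fun _ : Fin 1 => a) z := by
  have hintegrable := integrableOn_rpow_mul_branchProd_sub (θ := θ + 1) (by positivity)
    (a := fun _ : Fin 1 => a) (fun _ => le_rfl) hz one_pos (by simpa using hθ)
  have hw : ∀ t : ℝ, (a : ℂ) - (z - t) = (a - z) + t := fun t => by ring
  have hθ0 : (θ : ℂ) ≠ 0 := by exact_mod_cast hθ.ne'
  simp only [branchProd_const_fin_one, hw] at hintegrable ⊢
  refine (integral_Ioi_of_hasDerivAt_of_tendsto'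
    (f := fun t : ℝ => -(θ : ℂ)⁻¹ * Complex.exp (-(θ : ℂ) * Complex.log (a - z + t)))
    (fun t ht => ?_) hintegrable ((tendsto_exp_neg_mul_log_add_atTop hθ _).const_mul _)).trans ?_
  · have hm := sub_sub_ofReal_mem_slitPlane ht hz
    rw [hw] at hm
    refine ((hasDerivAt_exp_neg_mul_log_add θ hm).const_mul (-(θ : ℂ)⁻¹)).congr_deriv ?_
    rw [sub_self, Real.rpow_zero]
    field_simp
    simp
  · simp

theorem integral_rpow_mul_branchProd_add_one_sub {θ : ℝ} (hθ : 0 < θ) {a : ℝ} {z : ℂ}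
    (hz : (a : ℂ) - z ∈ Complex.slitPlane) :
    ∫ t in Set.Ioi (0 : ℝ), ((t ^ (θ - 1) : ℝ) : ℂ) *
        branchProd (θ + 1) (fun _ : Fin 1 => a) (z - t) =
      (θ : ℂ)⁻¹ * ((a : ℂ) - z)⁻¹ := by
  have hintegrable := integrableOn_rpow_mul_branchProd_sub (θ := θ + 1) (by positivity)
    (a := fun _ : Fin 1 => a) (fun _ => le_rfl) hz hθ (by simp)
  have hw : ∀ t : ℝ, (a : ℂ) - (z - t) = (a - z) + t := fun t => by ring
  have hθ0 : (θ : ℂ) ≠ 0 := by exact_mod_cast hθ.ne'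
  have hz0 := Complex.slitPlane_ne_zero hz
  simp only [branchProd_const_fin_one, hw] at hintegrable ⊢
  have hmem : ∀ t : ℝ, 0 ≤ t → (a - z) + (t : ℂ) ∈ Complex.slitPlane := fun t ht => by
    rw [← hw]
    exact sub_sub_ofReal_mem_slitPlane ht hz
  refine (integral_Ioi_of_hasDerivAt_of_tendsto
    (f := fun t : ℝ => ((θ : ℂ)⁻¹ * ((a : ℂ) - z)⁻¹) *
      (((t ^ θ : ℝ) : ℂ) * Complex.exp (-(θ : ℂ) * Complex.log (a - z + t))))
    ?_ (fun t ht => ?_) hintegrable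
    ((tendsto_rpow_mul_exp_neg_mul_log_add_atTop θ _).const_mul _)).trans ?_
  · refine ContinuousAt.continuousWithinAt (ContinuousAt.mul continuousAt_const ?_)
    refine ContinuousAt.mul ?_ (hasDerivAt_exp_neg_mul_log_add θ (hmem 0 le_rfl)).continuousAt
    exact Complex.continuous_ofReal.continuousAt.comp
      (Real.continuousAt_rpow_const _ _ (Or.inr hθ.le))
  · have ht0 : (0 : ℝ) < t := ht
    have hm := hmem t ht0.le
    have hm0 := Complex.slitPlane_ne_zero hm
    have hp : HasDerivAt (fun t : ℝ => ((t ^ θ : ℝ) : ℂ)) ((θ * t ^ (θ - 1) : ℝ) : ℂ) t :=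
      (Real.hasDerivAt_rpow_const (Or.inl ht0.ne')).ofReal_comp
    refine ((hp.mul (hasDerivAt_exp_neg_mul_log_add θ hm)).const_mul
      ((θ : ℂ)⁻¹ * ((a : ℂ) - z)⁻¹)).congr_deriv ?_
    have h3 : Complex.exp (-(θ : ℂ) * Complex.log (a - z + t)) =
        Complex.exp (-((θ + 1 : ℝ) : ℂ) * Complex.log (a - z + t)) * (a - z + t) := by
      conv_rhs => rw [← Complex.exp_log hm0, ← Complex.exp_add, Complex.exp_log hm0]
      push_cast
      ring_nf
    have h4 : t ^ θ = t ^ (θ - 1) * t := by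
      rw [← Real.rpow_add_one ht0.ne', sub_add_cancel]
    rw [h3, h4]
    push_cast
    field_simp
    ring
  · simp [Real.zero_rpow hθ.ne']

theorem contourInt_exp_mul_branchProd_fin_one {θ : ℝ} (hθ : 0 < θ) {a M r : ℝ} (hM : M < a)
    (hr : 0 < r) {y : ℂ} (hy : 0 < y.re) :
    (Real.Gamma θ : ℂ) * Complex.exp (((1 - θ : ℝ) : ℂ) * Complex.log y) *
        (contourInt M r fun z => Complex.exp (-y * z) * branchProd θ (fun _ : Fin 1 => a) z) =
      -(2 * Real.pi * Complex.I) * Complex.exp (-y * a) := by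
  have hθ0 : (θ : ℂ) ≠ 0 := by exact_mod_cast hθ.ne'
  have e1 := contourInt_exp_mul_integral_branchProd (θ := θ + 1) (by positivity)
    (a := fun _ : Fin 1 => a) (fun _ => le_rfl) hM hr hy one_pos (by simpa using hθ)
  have e2 := contourInt_exp_mul_integral_branchProd (θ := θ + 1) (by positivity)
    (a := fun _ : Fin 1 => a) (fun _ => le_rfl) hM hr hy hθ (by simp)
  rw [contourInt_congr hr fun z hz => by
    rw [integral_branchProd_add_one_sub hθ (hz.sub_mem_slitPlane hr hM), mul_left_comm],
    contourInt_const_mul, Real.Gamma_one] at e1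
  rw [contourInt_congr hr fun z hz => by
    rw [integral_rpow_mul_branchProd_add_one_sub hθ (hz.sub_mem_slitPlane hr hM), mul_left_comm],
    contourInt_const_mul, contourInt_exp_mul_inv hM hr hy] at e2
  set J := contourInt M r fun z => Complex.exp (-y * z) * branchProd θ (fun _ : Fin 1 => a) z
  set J' := contourInt M r fun z => Complex.exp (-y * z) *
    branchProd (θ + 1) (fun _ : Fin 1 => a) z
  have h1 : Complex.exp (((1 - θ : ℝ) : ℂ) * Complex.log y) *
      Complex.exp (-((1 : ℝ) : ℂ) * Complex.log y) =
      Complex.exp (-(θ : ℂ) * Complex.log y) := by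
    rw [← Complex.exp_add]
    push_cast
    ring_nf
  have e1' : J = θ * (Complex.exp (-((1 : ℝ) : ℂ) * Complex.log y) * J') := by
    field_simp at e1 ⊢
    push_cast at e1 ⊢
    linear_combination e1
  have e2' : -(2 * Real.pi * Complex.I) * Complex.exp (-y * a) =
      θ * (Real.Gamma θ * Complex.exp (-(θ : ℂ) * Complex.log y) * J') := by
    rw [← e2]
    field_simp
  rw [e1', e2', ← h1]
  ring

theorem integral_dixonDensity_mul_contourInt {θ : ℝ} (hθ : 0 < θ) {m : ℕ} (hm : 0 < m)
    {b : Fin (m + 1) → ℝ} (hb : StrictAnti b) {M r : ℝ} (hM : M < b (Fin.last m)) (hr : 0 < r)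
    {y : ℂ} (hy : 0 < y.re) :
    IntegrableOn (fun u => (dixonDensity θ b u : ℂ) *
        contourInt M r fun z => Complex.exp (-y * z) * branchProd θ u z) {u | Interlaces u b} ∧
      ((Real.Gamma (m * θ) * absVdm b ^ (1 - 2 * θ) : ℝ) : ℂ) *
        (∫ u in {u : Fin m → ℝ | Interlaces u b}, (dixonDensity θ b u : ℂ) *
          contourInt M r fun z => Complex.exp (-y * z) * branchProd θ u z) =
      ((Real.Gamma θ ^ (m + 1) : ℝ) : ℂ) * Complex.exp (-(θ : ℂ) * Complex.log y) *
        contourInt M r fun z => Complex.exp (-y * z) * branchProd θ b z := by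
  have hδ : 0 < min r (b (Fin.last m) - M) := lt_min hr (by linarith)
  have hswap := integral_contourInt_swap (μ := volume) (measurableSet_interlaces b) (M := M) hr hy
    (p := 0) le_rfl (F := fun u z => (dixonDensity θ b u : ℂ) * branchProd θ u z) (by fun_prop)
    ((integrableOn_dixonDensity hθ hm hb).mul_const
      ((min r (b (Fin.last m) - M) ^ (-θ)) ^ m)) fun u hu z hz => by
      rw [Real.rpow_zero, mul_one, norm_mul, Complex.norm_real,
        Real.norm_of_nonneg (dixonDensity_nonneg _ _ _)]
      exact mul_le_mul_of_nonneg_left (norm_branchProd_le hθ hδ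
        (fun i => (Interlaces.last_lt hb hu i).le) hz.farFromRay) (dixonDensity_nonneg _ _ _)
  simp only [mul_left_comm (Complex.exp _), contourInt_const_mul] at hswap
  refine ⟨hswap.1, ?_⟩
  rw [hswap.2, ← contourInt_const_mul]
  have hq : θ < ((m + 1 : ℕ) : ℝ) * θ := by
    have : (0 : ℝ) < m := by exact_mod_cast hm
    push_cast
    nlinarith
  have hL := contourInt_exp_mul_integral_branchProd hθ
    (fun i => hb.antitone (Fin.le_last i)) hM hr hy hθ hq
  rw [contourInt_congr hr fun z hz => by
    rw [mul_left_comm, integral_dixonDensity_mul_branchProd hθ hm hb (hz.sub_mem_slitPlane hr hM),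
      mul_left_comm], contourInt_const_mul, hL]
  push_cast
  ring

theorem measurable_lvl {N : ℕ} (a : Fin N → ℝ) (k : ℕ) (hk : k < N) (i : Fin (k + 1)) :
    Measurable fun x : Tri (N - 1) => lvl a x k hk i := by
  unfold lvl
  split_ifs
  · fun_prop
  · exact measurable_const

@[fun_prop]
theorem measurable_obpWt (θ : ℝ) {N : ℕ} (a : Fin N → ℝ) : Measurable (obpWt θ a) := by
  unfold obpWt
  refine Finset.measurable_prod _ fun k _ => Measurable.mul ?_ ?_
  · refine Finset.measurable_prod _ fun i _ => Finset.measurable_prod _ fun j _ => ?_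
    split_ifs
    · fun_prop
    · exact measurable_const
  · refine Finset.measurable_prod _ fun s _ => Finset.measurable_prod _ fun i _ => ?_
    have := measurable_lvl a (k.1 + 1) (by have := k.isLt; omega) s
    fun_prop

theorem obpWt_nonneg (θ : ℝ) {N : ℕ} (a : Fin N → ℝ) (x : Tri (N - 1)) : 0 ≤ obpWt θ a x := by
  unfold obpWt
  refine Finset.prod_nonneg fun k _ => mul_nonneg ?_ ?_
  · refine Finset.prod_nonneg fun i _ => Finset.prod_nonneg fun j _ => ?_
    split_ifs <;> positivity
  · exact Finset.prod_nonneg fun s _ => Finset.prod_nonneg fun i _ => by positivity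

theorem measurableSet_obpDomain {N : ℕ} (a : Fin N → ℝ) : MeasurableSet (obpDomain a) := by
  have : obpDomain a = ⋂ k : Fin (N - 1), ⋂ i : Fin (k.1 + 1),
      ({x | x k i < lvl a x (k.1 + 1) (by have := k.isLt; omega) i.castSucc} ∩
        {x | lvl a x (k.1 + 1) (by have := k.isLt; omega) i.succ < x k i}) := by
    ext x
    simp [obpDomain, Interlaces]
  rw [this]
  refine MeasurableSet.iInter fun k => MeasurableSet.iInter fun i => ?_
  exact (measurableSet_lt (by fun_prop) (measurable_lvl _ _ _ _)).inter
    (measurableSet_lt (measurable_lvl _ _ _ _) (by fun_prop))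

@[fun_prop]
theorem measurable_sumLvl {N : ℕ} (a : Fin N → ℝ) (k : ℕ) :
    Measurable fun x : Tri (N - 1) => sumLvl a x k := by
  unfold sumLvl
  split_ifs
  · exact measurable_const
  · fun_prop
  · exact measurable_const

/-- The array obtained from `x` by adding the top level `u`. -/
def Tri.snoc {n : ℕ} (x : Tri n) (u : Fin (n + 1) → ℝ) : Tri (n + 1) :=
  Fin.snoc (α := fun k : Fin (n + 1) => Fin (k.1 + 1) → ℝ) x u

theorem Tri.snoc_castSucc {n : ℕ} (x : Tri n) (u : Fin (n + 1) → ℝ) (k : Fin n) :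
    Tri.snoc x u k.castSucc = x k :=
  Fin.snoc_castSucc (α := fun k : Fin (n + 1) => Fin (k.1 + 1) → ℝ) u x k

theorem Tri.snoc_last {n : ℕ} (x : Tri n) (u : Fin (n + 1) → ℝ) :
    Tri.snoc x u (Fin.last n) = u :=
  Fin.snoc_last (α := fun k : Fin (n + 1) => Fin (k.1 + 1) → ℝ) u x

theorem Tri.snoc_apply_of_eq {n : ℕ} (x : Tri n) (u : Fin (n + 1) → ℝ) {k : ℕ} (hk : k < n + 1)
    (h : k = n) (j : Fin (k + 1)) : Tri.snoc x u ⟨k, hk⟩ j = u ⟨j.1, by omega⟩ := by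
  subst h
  exact congrFun (Tri.snoc_last x u) j

theorem measurePreserving_triSnoc (n : ℕ) :
    MeasurePreserving fun p : Tri n × (Fin (n + 1) → ℝ) => Tri.snoc p.1 p.2 :=
  measurePreserving_finSnoc (n := n) (α := fun k : Fin (n + 1) => Fin (k.1 + 1) → ℝ)

theorem measurableEmbedding_triSnoc (n : ℕ) :
    MeasurableEmbedding fun p : Tri n × (Fin (n + 1) → ℝ) => Tri.snoc p.1 p.2 :=
  measurableEmbedding_finSnoc (n := n) (α := fun k : Fin (n + 1) => Fin (k.1 + 1) → ℝ)

theorem lvl_snoc_castSucc {n : ℕ} (b : Fin (n + 2) → ℝ) (x : Tri n) (u : Fin (n + 1) → ℝ)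
    {k : ℕ} (hk : k < n + 1) (hk' : k < n + 2) :
    lvl b (Tri.snoc x u) k hk' = lvl u x k hk := by
  have h1 : k < n + 2 - 1 := hk
  ext i
  by_cases h : k < n
  · have h' : k < n + 1 - 1 := h
    simp only [lvl, dif_pos h1, dif_pos h']
    exact congrFun (Tri.snoc_castSucc x u ⟨k, h⟩) i
  · have h' : ¬k < n + 1 - 1 := h
    simp only [lvl, dif_pos h1, dif_neg h']
    exact Tri.snoc_apply_of_eq x u hk (by omega) i

theorem lvl_top {n : ℕ} (b : Fin (n + 1) → ℝ) (w : Tri n) :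
    lvl b w n n.lt_succ_self = b := by
  simp [lvl]

theorem snoc_mem_obpDomain {n : ℕ} (b : Fin (n + 2) → ℝ) (x : Tri n) (u : Fin (n + 1) → ℝ) :
    Tri.snoc x u ∈ obpDomain b ↔ x ∈ obpDomain u ∧ Interlaces u b := by
  have key : Tri.snoc x u ∈ obpDomain b ↔ ∀ k : Fin (n + 1), Interlaces (Tri.snoc x u k)
      (lvl b (Tri.snoc x u) (k.1 + 1) (by have := k.isLt; omega)) := Iff.rfl
  rw [key, Fin.forall_fin_succ']
  refine and_congr (forall_congr' fun k => ?_) ?_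
  · rw [Tri.snoc_castSucc]
    exact iff_of_eq (congrArg _
      (lvl_snoc_castSucc b x u (k := k.1 + 1) (by have := k.isLt; omega) (by have := k.isLt; omega)))
  · rw [Tri.snoc_last]
    exact iff_of_eq (congrArg _ (lvl_top b _))

theorem obpWt_snoc (θ : ℝ) {n : ℕ} (b : Fin (n + 2) → ℝ) (x : Tri n) (u : Fin (n + 1) → ℝ) :
    obpWt θ b (Tri.snoc x u) = obpWt θ u x *
      (absVdm u ^ (2 - 2 * θ) * ∏ s, ∏ r, |b s - u r| ^ (θ - 1)) := by
  have key : ∀ {N : ℕ} (c : Fin (N + 1) → ℝ) (w : Tri N), obpWt θ c w =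
      ∏ k : Fin N, (absVdm (w k) ^ (2 - 2 * θ) * ∏ s : Fin (k.1 + 2), ∏ r : Fin (k.1 + 1),
        |lvl c w (k.1 + 1) (by have := k.isLt; omega) s - w k r| ^ (θ - 1)) := by
    intro N c w
    simp only [← prod_abs_sub_rpow]
    rfl
  rw [key, key, Fin.prod_univ_castSucc]
  congr 1
  · refine Finset.prod_congr rfl fun k _ => ?_
    rw [Tri.snoc_castSucc]
    refine congrArg₂ _ rfl ?_
    refine Finset.prod_congr rfl fun s _ => Finset.prod_congr rfl fun i _ => ?_
    have := congrFun (lvl_snoc_castSucc b x u (k := k.1 + 1) (by have := k.isLt; omega)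
      (by have := k.isLt; omega)) s
    exact congrArg (fun v => |v - x k i| ^ (θ - 1)) this
  · rw [Tri.snoc_last]
    refine congrArg₂ _ rfl ?_
    refine Finset.prod_congr rfl fun s _ => Finset.prod_congr rfl fun i _ => ?_
    exact congrArg (fun v => |v - u i| ^ (θ - 1)) (congrFun (lvl_top b (Tri.snoc x u)) s)

theorem sumLvl_one_snoc {n : ℕ} (b : Fin (n + 2) → ℝ) (x : Tri n) (u : Fin (n + 1) → ℝ) :
    sumLvl b (Tri.snoc x u) 1 = sumLvl u x 1 := by
  have h1 : sumLvl b (Tri.snoc x u) 1 = ∑ i, Tri.snoc x u 0 i := by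
    simp [sumLvl]
    rfl
  rw [h1]
  rcases n with - | n
  · exact Finset.sum_congr rfl fun i _ => congrFun (Tri.snoc_last x u) i
  · have h2 : sumLvl u x 1 = ∑ i, x 0 i := by
      simp [sumLvl]
      rfl
    rw [h2]
    exact Finset.sum_congr rfl fun i _ => congrFun (Tri.snoc_castSucc x u 0) i

/-- The normalizing constant of the multivariate Bessel function in `N` variables. -/
def besselConst (θ : ℝ) (N : ℕ) : ℝ :=
  (∏ k : Fin N, Real.Gamma ((k.1 + 1) * θ)) / Real.Gamma θ ^ (N * (N + 1) / 2)

theorem besselConst_pos {θ : ℝ} (hθ : 0 < θ) (N : ℕ) : 0 < besselConst θ N := by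
  have hG := Real.Gamma_pos_of_pos hθ
  exact div_pos (Finset.prod_pos fun k _ => Real.Gamma_pos_of_pos (by positivity)) (by positivity)

theorem besselConst_succ (θ : ℝ) (N : ℕ) :
    besselConst θ (N + 1) =
      besselConst θ N * (Real.Gamma ((N + 1) * θ) / Real.Gamma θ ^ (N + 1)) := by
  have h : (N + 1) * (N + 1 + 1) / 2 = N * (N + 1) / 2 + (N + 1) := by
    rw [← Nat.add_mul_div_right _ _ two_pos]
    congr 1
    ring
  rw [besselConst, besselConst, Fin.prod_univ_castSucc, h, pow_add, mul_div_mul_comm]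
  rfl

/-- The integrand of `𝓑_a(-y, 0, …, 0; θ)`, extended by zero. -/
def besselIntegrand (θ : ℝ) {N : ℕ} (a : Fin N → ℝ) (y : ℂ) : Tri (N - 1) → ℂ :=
  (obpDomain a).indicator fun x => Complex.exp (-y * sumLvl a x 1) * obpWt θ a x

theorem measurable_besselIntegrand (θ : ℝ) {N : ℕ} (a : Fin N → ℝ) (y : ℂ) :
    Measurable (besselIntegrand θ a y) :=
  Measurable.indicator (by fun_prop) (measurableSet_obpDomain a)

theorem norm_besselIntegrand (θ : ℝ) {N : ℕ} (a : Fin N → ℝ) (y : ℂ) (x : Tri (N - 1)) :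
    (‖besselIntegrand θ a y x‖ : ℂ) = besselIntegrand θ a (y.re : ℂ) x := by
  by_cases hx : x ∈ obpDomain a
  · rw [besselIntegrand, besselIntegrand, Set.indicator_of_mem hx, Set.indicator_of_mem hx, norm_mul,
      Complex.norm_exp, Complex.norm_real, Real.norm_of_nonneg (obpWt_nonneg θ a x)]
    simp
  · simp [besselIntegrand, hx]

theorem besselIntegrand_snoc (θ : ℝ) {n : ℕ} (b : Fin (n + 2) → ℝ) (y : ℂ) (x : Tri n)
    (u : Fin (n + 1) → ℝ) :
    besselIntegrand θ b y (Tri.snoc x u) =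
      {u : Fin (n + 1) → ℝ | Interlaces u b}.indicator (fun u =>
        ((absVdm u ^ (2 - 2 * θ) * ∏ s, ∏ r, |b s - u r| ^ (θ - 1) : ℝ) : ℂ)) u *
        besselIntegrand θ u y x := by
  by_cases hu : Interlaces u b
  · by_cases hx : x ∈ obpDomain u
    · rw [besselIntegrand, besselIntegrand, Set.indicator_of_mem hx,
        Set.indicator_of_mem ((snoc_mem_obpDomain b x u).2 ⟨hx, hu⟩),
        Set.indicator_of_mem (show u ∈ {u | Interlaces u b} from hu), obpWt_snoc, sumLvl_one_snoc]
      push_cast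
      ring
    · rw [besselIntegrand, besselIntegrand, Set.indicator_of_notMem hx,
        Set.indicator_of_notMem fun h => hx ((snoc_mem_obpDomain b x u).1 h).1, mul_zero]
  · rw [besselIntegrand, Set.indicator_of_notMem fun h => hu ((snoc_mem_obpDomain b x u).1 h).2,
      Set.indicator_of_notMem (show u ∉ {u | Interlaces u b} from hu), zero_mul]

theorem rpow_mul_eq_dixonDensity {θ : ℝ} {m : ℕ} {b : Fin (m + 1) → ℝ} {u : Fin m → ℝ}
    (hu : StrictAnti u) :
    absVdm u ^ (2 - 2 * θ) * (∏ s, ∏ r, |b s - u r| ^ (θ - 1)) * absVdm u ^ (2 * θ - 1) =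
      dixonDensity θ b u := by
  rw [mul_right_comm, ← Real.rpow_add (absVdm_pos hu.injective)]
  rw [show 2 - 2 * θ + (2 * θ - 1) = 1 by ring, Real.rpow_one]
  rfl

theorem integral_besselIntegrand {θ : ℝ} (hθ : 0 < θ) (n : ℕ) {b : Fin (n + 1) → ℝ}
    (hb : StrictAnti b) {y : ℂ} (hy : 0 < y.re) {M r : ℝ} (hM : M < b (Fin.last n))
    (hr : 0 < r) :
    Integrable (besselIntegrand θ b y) ∧
      ∫ x : Tri n, besselIntegrand θ b y x =
        (Real.Gamma ((n + 1) * θ) / besselConst θ (n + 1) : ℝ) *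
          ((absVdm b ^ (2 * θ - 1) : ℝ) : ℂ) *
          (Complex.exp (((1 - (n + 1) * θ : ℝ) : ℂ) * Complex.log y) *
            (-(2 * Real.pi * Complex.I)⁻¹ *
              contourInt M r fun z => Complex.exp (-y * z) * branchProd θ b z)) := by
  induction n generalizing y M with
  | zero =>
    have hval : besselIntegrand θ b y = fun _ => Complex.exp (-y * b 0) := by
      ext x
      simp [besselIntegrand, obpDomain, obpWt, sumLvl]
    have hfin : IsFiniteMeasure (volume : Measure (Tri 0)) := by
      rw [volume_pi]
      infer_instance
    have hone : (volume : Measure (Tri 0)).real Set.univ = 1 := by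
      rw [measureReal_def, volume_pi, Measure.pi_empty_univ, ENNReal.toReal_one]
    have hbase := contourInt_exp_mul_branchProd_fin_one hθ hM hr hy
    have hconst : (fun _ : Fin 1 => b (Fin.last 0)) = b := by
      ext i
      rw [Subsingleton.elim i (Fin.last 0)]
    rw [hconst] at hbase
    have hG := Real.Gamma_pos_of_pos hθ
    have hK : Real.Gamma (((0 : ℕ) + 1) * θ) / besselConst θ (0 + 1) = Real.Gamma θ := by
      simp [besselConst, hG.ne']
    have hV : absVdm b = 1 := by simp [absVdm]
    refine ⟨hval ▸ integrable_const _, ?_⟩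
    have hintegrable : ∫ x : Tri 0, besselIntegrand θ b y x = Complex.exp (-y * b 0) := by
      rw [hval]
      refine (integral_const _).trans ?_
      rw [hone, one_smul]
    rw [hintegrable, hK, hV, Real.one_rpow, Complex.ofReal_one, mul_one, Nat.cast_zero,
      show (0 : ℝ) + 1 = 1 from zero_add 1, one_mul]
    have hpi : (2 * (Real.pi : ℂ) * Complex.I) ≠ 0 := by simp [Real.pi_ne_zero]
    calc Complex.exp (-y * b 0) = -(2 * Real.pi * Complex.I)⁻¹ *
          (-(2 * Real.pi * Complex.I) * Complex.exp (-y * b (Fin.last 0))) := by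
          rw [← mul_assoc, neg_mul_neg, inv_mul_cancel₀ hpi, one_mul]
          rfl
      _ = _ := by
          rw [← hbase]
          ring
  | succ n ih =>
    set S : Set (Fin (n + 1) → ℝ) := {u | Interlaces u b} with hS
    set c : ℂ → ℂ := fun w => (Real.Gamma ((n + 1) * θ) / besselConst θ (n + 1) : ℝ) *
      Complex.exp (((1 - (n + 1) * θ : ℝ) : ℂ) * Complex.log w) *
      -(2 * Real.pi * Complex.I)⁻¹ with hc
    have hslice : ∀ {w : ℂ}, 0 < w.re → ∀ u : Fin (n + 1) → ℝ,
        Integrable (fun x => besselIntegrand θ b w (Tri.snoc x u)) ∧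
          ∫ x, besselIntegrand θ b w (Tri.snoc x u) = S.indicator (fun u => c w *
            ((dixonDensity θ b u : ℂ) *
              contourInt M r fun z => Complex.exp (-w * z) * branchProd θ u z)) u := by
      intro w hw u
      simp only [besselIntegrand_snoc, ← hS]
      by_cases hu : u ∈ S
      · have hu' := Interlaces.strictAnti hb hu
        obtain ⟨h1, h2⟩ := ih hu' hw (hM.trans (Interlaces.last_lt hb hu _))
        refine ⟨h1.const_mul _, ?_⟩
        rw [integral_const_mul, h2, Set.indicator_of_mem hu, Set.indicator_of_mem hu,
          ← rpow_mul_eq_dixonDensity hu', hc]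
        push_cast
        ring
      · simp [Set.indicator_of_notMem hu]
    have hD := fun {w : ℂ} (hw : 0 < w.re) =>
      integral_dixonDensity_mul_contourInt hθ n.succ_pos hb hM hr hw
    have hintegrable : ∀ {w : ℂ}, 0 < w.re → Integrable (S.indicator fun u => c w *
        ((dixonDensity θ b u : ℂ) *
          contourInt M r fun z => Complex.exp (-w * z) * branchProd θ u z)) := fun hw =>
      (integrable_indicator_iff (measurableSet_interlaces b)).2 ((hD hw).1.const_mul _)
    have hprod : Integrable fun p : Tri n × (Fin (n + 1) → ℝ) =>
        besselIntegrand θ b y (Tri.snoc p.1 p.2) := by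
      refine (integrable_prod_iff' ?_).2 ⟨.of_forall fun u => (hslice hy u).1, ?_⟩
      · exact ((measurable_besselIntegrand θ b y).comp
          (measurePreserving_triSnoc n).measurable).aestronglyMeasurable
      · have hy' : 0 < ((y.re : ℝ) : ℂ).re := by simpa using hy
        refine (hintegrable hy').re.congr (.of_forall fun u => ?_)
        simp only [← (hslice hy' u).2, ← norm_besselIntegrand]
        rw [integral_complex_ofReal]
        exact Complex.ofReal_re _
    refine ⟨((measurePreserving_triSnoc n).integrable_comp_emb
      (measurableEmbedding_triSnoc n)).1 hprod, ?_⟩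
    have hmap := (measurePreserving_triSnoc n).integral_comp (measurableEmbedding_triSnoc n)
      (besselIntegrand θ b y)
    refine hmap.symm.trans ?_
    have hV := absVdm_pos hb.injective
    have hB := besselConst_pos hθ (n + 1)
    have hGm : 0 < Real.Gamma ((n + 1 : ℕ) * θ) := Real.Gamma_pos_of_pos (by positivity)
    have hGm' : 0 < Real.Gamma (((n + 1 : ℕ) + 1) * θ) := Real.Gamma_pos_of_pos (by positivity)
    have hG := Real.Gamma_pos_of_pos hθ
    have hinv : absVdm b ^ (2 * θ - 1) * absVdm b ^ (1 - 2 * θ) = 1 := by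
      rw [← Real.rpow_add hV]
      simp
    have hexp : Complex.exp (((1 - ((n + 1 : ℕ) + 1) * θ : ℝ) : ℂ) * Complex.log y) =
        Complex.exp (((1 - (n + 1) * θ : ℝ) : ℂ) * Complex.log y) *
          Complex.exp (-(θ : ℂ) * Complex.log y) := by
      rw [← Complex.exp_add]
      congr 1
      push_cast
      ring
    have hDy := (hD hy).2
    rw [Measure.volume_eq_prod, integral_prod_symm _ hprod]
    simp only [(hslice hy _).2]
    rw [integral_indicator (measurableSet_interlaces b), integral_const_mul, hexp,
      besselConst_succ]
    set X := ∫ u in S, (dixonDensity θ b u : ℂ) *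
      contourInt M r fun z => Complex.exp (-y * z) * branchProd θ u z
    set J := contourInt M r fun z => Complex.exp (-y * z) * branchProd θ b z
    have hX : X = ((absVdm b ^ (2 * θ - 1) / Real.Gamma ((n + 1 : ℕ) * θ) : ℝ) : ℂ) *
        (((Real.Gamma θ ^ (n + 1 + 1) : ℝ) : ℂ) * Complex.exp (-(θ : ℂ) * Complex.log y) * J) := by
      rw [← hDy, ← mul_assoc, ← Complex.ofReal_mul, show absVdm b ^ (2 * θ - 1) /
        Real.Gamma ((n + 1 : ℕ) * θ) * (Real.Gamma ((n + 1 : ℕ) * θ) * absVdm b ^ (1 - 2 * θ)) = 1 by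
          field_simp; exact hinv, Complex.ofReal_one, one_mul]
    have hK : Real.Gamma (((n + 1 : ℕ) + 1) * θ) / (besselConst θ (n + 1) *
        (Real.Gamma (((n + 1 : ℕ) + 1) * θ) / Real.Gamma θ ^ (n + 1 + 1))) =
        Real.Gamma ((n + 1) * θ) / besselConst θ (n + 1) *
          (Real.Gamma θ ^ (n + 1 + 1) / Real.Gamma ((n + 1 : ℕ) * θ)) := by
      push_cast at hGm ⊢
      field_simp
    rw [hX, hK, hc]
    push_cast
    ring

/-- (Theorem 5.2) Contour integral representation of
`𝓑_a(-y, 0^{N-1}; θ)` for `Re y > 0`, over the counter-clockwise contour consisting of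
the ray from `+∞ + ri` to `M + ri`, the segment from `M + ri` to `M - ri` and the ray
from `M - ri` to `+∞ - ri`, with `M < a_N`. -/
theorem mbf_contour_right
    (θ : ℝ) (hθ : 0 < θ) (N : ℕ) (hN : 1 ≤ N)
    (a : Fin N → ℝ) (ha : StrictAnti a)
    (y : ℂ) (hy : 0 < y.re) (M r : ℝ) (hM : M < a ⟨N - 1, by omega⟩) (hr : 0 < r) :
    IntegrableOn (fun t : ℝ => contourFnR θ a y (t + r * Complex.I)) (Set.Ici M)
        volume ∧
    IntegrableOn (fun t : ℝ => contourFnR θ a y (t - r * Complex.I)) (Set.Ici M)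
        volume ∧
    MBF θ a (fun k => if k.1 = 0 then -y else 0) =
      -(((Real.Gamma (θ * N) : ℂ) /
            Complex.exp (((θ * N - 1 : ℝ) : ℂ) * Complex.log y)) *
          (2 * (Real.pi : ℂ) * Complex.I)⁻¹ *
          (-(∫ t in Set.Ici M, contourFnR θ a y (t + r * Complex.I)) -
            Complex.I * (∫ s in (-r)..r, contourFnR θ a y (M + s * Complex.I)) +
            ∫ t in Set.Ici M, contourFnR θ a y (t - r * Complex.I))) := by
  obtain ⟨n, rfl⟩ : ∃ n, N = n + 1 := ⟨N - 1, by omega⟩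
  have hM' : M < a (Fin.last n) := hM
  have hcv := integrableOn_Ici_exp_mul_branchProd hθ
    (fun i => ha.antitone (Fin.le_last i)) hM' hr hy
  refine ⟨hcv.1, hcv.2, ?_⟩
  have hexponent : ∀ x : Tri n, (∑ k : Fin (n + 1), (if k.1 = 0 then -y else 0) *
      ((sumLvl a x (k.1 + 1) - sumLvl a x k.1 : ℝ) : ℂ)) = -y * sumLvl a x 1 := by
    intro x
    have h0 : sumLvl a x 0 = 0 := rfl
    rw [Fin.sum_univ_succ]
    simp [h0]
  have hmain := (integral_besselIntegrand hθ n ha hy hM' hr).2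
  have hMBF : MBF θ a (fun k => if k.1 = 0 then -y else 0) =
      (besselConst θ (n + 1) : ℂ) * ((absVdm a ^ (1 - 2 * θ) : ℝ) : ℂ) *
        ∫ x : Tri n, besselIntegrand θ a y x := by
    rw [MBF, prod_abs_sub_rpow]
    refine congrArg₂ _ rfl ?_
    refine Eq.trans ?_ (integral_indicator (measurableSet_obpDomain a)).symm
    exact integral_congr_ae (.of_forall fun x => by simp only [hexponent])
  have hB := besselConst_pos hθ (n + 1)
  have hinv : absVdm a ^ (1 - 2 * θ) * absVdm a ^ (2 * θ - 1) = 1 := by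
    rw [← Real.rpow_add (absVdm_pos ha.injective)]
    simp
  have hK : besselConst θ (n + 1) * absVdm a ^ (1 - 2 * θ) *
      (Real.Gamma ((n + 1) * θ) / besselConst θ (n + 1) * absVdm a ^ (2 * θ - 1)) =
      Real.Gamma (θ * (n + 1 : ℕ)) := by
    rw [mul_mul_mul_comm, hinv, mul_one, mul_div_cancel₀ _ hB.ne', mul_comm θ]
    push_cast
    rfl
  have hexp : Complex.exp (((1 - (n + 1) * θ : ℝ) : ℂ) * Complex.log y) =
      (Complex.exp (((θ * (n + 1 : ℕ) - 1 : ℝ) : ℂ) * Complex.log y))⁻¹ := by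
    rw [← Complex.exp_neg]
    congr 1
    push_cast
    ring
  rw [hMBF, hmain, ← Complex.ofReal_mul, ← Complex.ofReal_mul, ← mul_assoc, ← Complex.ofReal_mul,
    hK, hexp]
  change _ = -((Real.Gamma (θ * (n + 1 : ℕ)) : ℂ) / _ * _ *
    contourInt M r fun z => Complex.exp (-y * z) * branchProd θ a z)
  rw [div_eq_mul_inv]
  ring

end
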